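/- Let u be a weak supersolution of ∂ₜu + 𝓛u = Δu in Ω × (0,T) with u ≥ 0 on B_R(x₀) × (t₀ − r², t₀), where B_R(x₀) × (t₀ − r², t₀) ⊂ Ω × (0,T), 0 < r ≤ 1 and r < R/2. Let d > 0 and set v = u + l with l ≥ (r/R)² · Tail_∞(u₋; x₀, R, t₀ − r², t₀) + d. Then there exist constants C > 0 depending only on N, s, Λ and θ > 0 depending only on N such that for every β ∈ (0,1) and all σ', σ with 1/2 ≤ σ' < σ ≤ 1 one has esssup_{U⁻(σ'r)} v^{−1} ≤ ( C (σ − σ')^{−θ} )^{1/β} · ( ⨍_{U⁻(σr)} v^{−β} dx dt )^{1/β}, where U⁻(ηr) = B_{ηr}(x₀) × (t₀ − (ηr)², t₀) for 1/2 ≤ η ≤ 1. -/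

import Mathlib

open MeasureTheory Metric Set
open scoped RealInnerProductSpace ENNReal

noncomputable section

/-- Euclidean space `ℝ^N`. -/
abbrev E (N : ℕ) : Type := EuclideanSpace ℝ (Fin N)

/-- The kernel `K` is measurable, symmetric in its first two arguments, and comparable to
the fractional kernel `|x-y|^{-(N+2s)}` with constant `Λ`, uniformly for `t ∈ (0,T)`. -/
def KernelOK (N : ℕ) (s Λ T : ℝ) (K : E N → E N → ℝ → ℝ) : Prop :=
  Measurable (fun p : E N × E N × ℝ => K p.1 p.2.1 p.2.2) ∧
  (∀ x y t, K x y t = K y x t) ∧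
  ∀ x y : E N, x ≠ y → ∀ t ∈ Set.Ioo 0 T,
    Λ⁻¹ * ‖x - y‖ ^ (-((N : ℝ) + 2 * s)) ≤ K x y t ∧
      K x y t ≤ Λ * ‖x - y‖ ^ (-((N : ℝ) + 2 * s))

/-- `u` is a (bounded, measurable, smooth in `Ω × (0,T)`) weak supersolution of
`∂ₜ u + 𝓛 u = Δ u` in `Ω × (0,T)`. -/
def IsWeakSupersolution (N : ℕ) (T : ℝ) (K : E N → E N → ℝ → ℝ)
    (Ω : Set (E N)) (u : E N → ℝ → ℝ) : Prop :=
  Measurable (fun p : E N × ℝ => u p.1 p.2) ∧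
  (∃ M : ℝ, ∀ x t, t ∈ Set.Ioo 0 T → |u x t| ≤ M) ∧
  ContDiffOn ℝ (⊤ : ℕ∞) (fun p : E N × ℝ => u p.1 p.2) (Ω ×ˢ Set.Ioo 0 T) ∧
  ∀ φ : E N → ℝ → ℝ,
    ContDiff ℝ (⊤ : ℕ∞) (fun p : E N × ℝ => φ p.1 p.2) →
    HasCompactSupport (fun p : E N × ℝ => φ p.1 p.2) →
    tsupport (fun p : E N × ℝ => φ p.1 p.2) ⊆ Ω ×ˢ Set.Ioo 0 T →
    (∀ x t, 0 ≤ φ x t) →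
    0 ≤ -(∫ t in Set.Ioo 0 T, ∫ x in Ω, u x t * deriv (fun τ => φ x τ) t) +
        (∫ t in Set.Ioo 0 T, ∫ x in Ω,
          ⟪gradient (fun y => u y t) x, gradient (fun y => φ y t) x⟫) +
        ∫ t in Set.Ioo 0 T, ∫ x : E N, ∫ y : E N,
          (u x t - u y t) * (φ x t - φ y t) * K x y t

/-- The negative part `u₋ = max(-u, 0)`. -/
def uminus (N : ℕ) (u : E N → ℝ → ℝ) : E N → ℝ → ℝ := fun x t => max (-(u x t)) 0

/-- The parabolic tail `Tail_∞(w; x₀, ρ, t₁, t₂)`. -/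
def tailInfty (N : ℕ) (s : ℝ) (w : E N → ℝ → ℝ) (x₀ : E N) (ρ t₁ t₂ : ℝ) : ℝ :=
  ρ ^ 2 * essSup
      (fun t => ∫ y in (Metric.ball x₀ ρ)ᶜ, |w y t| * ‖y - x₀‖ ^ (-((N : ℝ) + 2 * s)))
      (volume.restrict (Set.Ioo t₁ t₂))

theorem aux_integral_le {α : Type*} [MeasurableSpace α] {μ : Measure α} {F H : α → ℝ}
    (hH : Integrable H μ) (h0 : 0 ≤ᵐ[μ] H) (hle : F ≤ᵐ[μ] H) : ∫ x, F x ∂μ ≤ ∫ x, H x ∂μ := by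
  by_cases hF : Integrable F μ
  · exact integral_mono_ae hF hH hle
  · rw [integral_undef hF]; exact integral_nonneg_of_ae h0

theorem aux_alg_le {a b q α γ : ℝ} (hb : 0 < b) (hab : b ≤ a) (hq : 0 < q)
    (hγ : 0 ≤ γ) :
    (a - b) * (a ^ (-(q+1)) * α ^ 2 - b ^ (-(q+1)) * γ ^ 2) ≤ 2 * a ^ (-q) * (α - γ) ^ 2 := by
  have ha : 0 < a := hb.trans_le hab
  set A := a ^ (-(q+2)) with hA
  have hApos : 0 < A := Real.rpow_pos_of_pos ha _
  have e1 : a ^ (-(q+1)) = A * a := by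
    rw [hA, ← Real.rpow_add_one ha.ne']; congr 1; ring
  have e2 : a ^ (-q) = A * a ^ 2 := by
    rw [hA, ← Real.rpow_natCast, ← Real.rpow_add ha]; congr 1; push_cast; ring
  -- b ^ (-(q+1)) ≥ a^(-(q+1)) + (a-b) * A
  have e3 : A * a + (a - b) * A ≤ b ^ (-(q+1)) := by
    have h1 : (1:ℝ) + (q+1) * (a/b - 1) ≤ (1 + (a/b-1)) ^ (q+1) := by
      apply one_add_mul_self_le_rpow_one_add
      · have : 0 < a / b := by positivity
        linarith
      · linarith
    have h2 : (1 + (a/b-1)) ^ (q+1) = b ^ (-(q+1)) * a ^ (q+1) := by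
      rw [show (1 + (a/b-1)) = a / b by ring, Real.div_rpow ha.le hb.le, Real.rpow_neg hb.le]
      field_simp
    have h3 : A * a * a ^ (q+1) = 1 := by
      rw [← e1, ← Real.rpow_add ha]; simp
    have h4 : (1:ℝ) + (a - b) / a ≤ 1 + (q+1) * (a/b - 1) := by
      have : (a-b)/a ≤ (a - b)/b := by
        apply div_le_div_of_nonneg_left <;> linarith
      have h5 : a/b - 1 = (a-b)/b := by field_simp
      have h6 : 0 ≤ (a-b)/b := div_nonneg (by linarith) hb.le
      rw [h5]; nlinarith
    have h7 : 1 + (a-b)/a ≤ b ^ (-(q+1)) * a ^ (q+1) := h4.trans (h1.trans h2.le)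
    have h8 := mul_le_mul_of_nonneg_left h7 (by positivity : 0 ≤ A * a)
    have h9 : A * a * (b ^ (-(q+1)) * a ^ (q+1)) = b ^ (-(q+1)) := by
      calc _ = (A * a * a ^ (q+1)) * b ^ (-(q+1)) := by ring
        _ = _ := by rw [h3, one_mul]
    rw [h9] at h8
    have h10 : A * a * (1 + (a-b)/a) = A * a + (a-b) * A := by field_simp
    linarith
  rw [e1, e2]
  have h11 : (a - b) * ((A * a + (a - b) * A) * γ ^ 2) ≤ (a-b) * (b ^ (-(q+1)) * γ ^ 2) := by
    apply mul_le_mul_of_nonneg_left _ (by linarith)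
    apply mul_le_mul_of_nonneg_right e3 (by positivity)
  have h12 : (a - b) * (A * a * α ^ 2 - (A * a + (a - b) * A) * γ ^ 2) ≤ 2 * (A * a ^ 2) * (α - γ) ^ 2 := by
    have : (a - b) * (a * α ^ 2 - (a + (a - b)) * γ ^ 2) ≤ 2 * (a ^ 2) * (α - γ) ^ 2 := by
      nlinarith [sq_nonneg (γ * (a-b) - a * (α - γ)), mul_nonneg (mul_nonneg ha.le hb.le) (sq_nonneg (α-γ))]
    calc _ = A * ((a - b) * (a * α ^ 2 - (a + (a - b)) * γ ^ 2)) := by ring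
      _ ≤ A * (2 * (a ^ 2) * (α - γ) ^ 2) := mul_le_mul_of_nonneg_left this hApos.le
      _ = _ := by ring
  nlinarith

theorem aux_alg {a b q α γ : ℝ} (ha : 0 < a) (hb : 0 < b) (hq : 0 < q) (hα : 0 ≤ α)
    (hγ : 0 ≤ γ) :
    (a - b) * (a ^ (-(q+1)) * α ^ 2 - b ^ (-(q+1)) * γ ^ 2) ≤
      2 * (a ^ (-q) + b ^ (-q)) * (α - γ) ^ 2 := by
  have h1 : 0 < a ^ (-q) := Real.rpow_pos_of_pos ha _
  have h2 : 0 < b ^ (-q) := Real.rpow_pos_of_pos hb _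
  have h3 := sq_nonneg (α - γ)
  rcases le_total b a with h | h
  · have := aux_alg_le (α := α) hb h hq hγ
    nlinarith
  · have := aux_alg_le (α := γ) ha h hq hα
    nlinarith

theorem aux_smooth_lip : ∃ M : ℝ, 1 ≤ M ∧ ∀ x y : ℝ,
    |Real.smoothTransition x - Real.smoothTransition y| ≤ M * |x - y| := by
  let f : ℝ → ℝ := fun x => Real.smoothTransition x * Real.smoothTransition (2 - x)
  have hf : ContDiff ℝ 1 f := by
    have h : ContDiff ℝ ((1:ℕ∞)) Real.smoothTransition := Real.smoothTransition.contDiff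
    exact h.mul (h.comp (contDiff_const.sub contDiff_id))
  have hs : HasCompactSupport f := by
    apply HasCompactSupport.intro (isCompact_Icc (a := (0:ℝ)) (b := 2))
    intro x hx
    simp only [mem_Icc, not_and_or, not_le] at hx
    rcases hx with h | h
    · simp [f, Real.smoothTransition.zero_of_nonpos h.le]
    · simp [f, Real.smoothTransition.zero_of_nonpos (by linarith : 2 - x ≤ 0)]
  obtain ⟨C, hC⟩ := hf.lipschitzWith_of_hasCompactSupport hs one_ne_zero
  refine ⟨max 1 C, le_max_left _ _, fun x y => ?_⟩
  have key : ∀ x, Real.smoothTransition x = f (min x 1) := by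
    intro x
    rcases le_total x 1 with h | h
    · simp [f, h, Real.smoothTransition.one_of_one_le (by linarith : 1 ≤ 2 - x)]
    · simp only [f, min_eq_right h]
      norm_num [Real.smoothTransition.one_of_one_le h, Real.smoothTransition.one]
  rw [key x, key y]
  have h1 := hC.dist_le_mul (min x 1) (min y 1)
  rw [Real.dist_eq, Real.dist_eq] at h1
  have h2 : |min x 1 - min y 1| ≤ |x - y| := by
    have := abs_min_sub_min_le_max x 1 y 1
    simpa using this
  calc _ ≤ _ := h1
    _ ≤ max 1 (C:ℝ) * |x - y| := by
      apply mul_le_mul (le_max_right _ _) h2 (abs_nonneg _) (by positivity)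

theorem aux_cutoff : ∃ M : ℝ, 1 ≤ M ∧ ∀ (N : ℕ) (x₀ : E N) (ρ₂ ρ₁ : ℝ), 0 < ρ₂ → ρ₂ < ρ₁ →
    ∃ ψ : E N → ℝ, ContDiff ℝ (⊤ : ℕ∞) ψ ∧ (∀ x, 0 ≤ ψ x) ∧ (∀ x, ψ x ≤ 1) ∧
      (∀ x, x ∉ closedBall x₀ ρ₁ → ψ x = 0) ∧ (∀ x ∈ closedBall x₀ ρ₂, ψ x = 1) ∧
      (∀ x y, |ψ x - ψ y| ≤ M / (ρ₁ - ρ₂) * ‖x - y‖) := by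
  obtain ⟨M, hM, hl⟩ := aux_smooth_lip
  refine ⟨M, hM, fun N x₀ ρ₂ ρ₁ h2 h12 => ?_⟩
  have hd : 0 < ρ₁ - ρ₂ := by linarith
  refine ⟨fun x => Real.smoothTransition ((ρ₁ - ‖x - x₀‖) / (ρ₁ - ρ₂)), ?_,
    fun x => Real.smoothTransition.nonneg _, fun x => Real.smoothTransition.le_one _, ?_, ?_, ?_⟩
  · rw [contDiff_iff_contDiffAt]
    intro x
    by_cases hx : x = x₀
    · subst hx
      have : (fun y : E N => Real.smoothTransition ((ρ₁ - ‖y - x‖) / (ρ₁ - ρ₂))) =ᶠ[nhds x]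
          fun _ => 1 := by
        filter_upwards [ball_mem_nhds x h2] with y hy
        apply Real.smoothTransition.one_of_one_le
        rw [le_div_iff₀ hd]
        rw [mem_ball, dist_eq_norm] at hy; linarith
      exact contDiffAt_const.congr_of_eventuallyEq this
    · apply Real.smoothTransition.contDiffAt.comp x
      apply ContDiffAt.div_const
      apply contDiffAt_const.sub
      exact (contDiffAt_id.sub contDiffAt_const).norm ℝ (by simpa [sub_eq_zero] using hx)
  · intro x hx
    apply Real.smoothTransition.zero_of_nonpos
    rw [mem_closedBall, dist_eq_norm, not_le] at hx
    apply div_nonpos_of_nonpos_of_nonneg <;> linarith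
  · intro x hx
    rw [mem_closedBall, dist_eq_norm] at hx
    apply Real.smoothTransition.one_of_one_le
    rw [le_div_iff₀ hd]; linarith
  · intro x y
    refine (hl _ _).trans ?_
    rw [← sub_div, abs_div, abs_of_pos hd]
    have h : |ρ₁ - ‖x - x₀‖ - (ρ₁ - ‖y - x₀‖)| ≤ ‖x - y‖ := by
      have := abs_norm_sub_norm_le (y - x₀) (x - x₀)
      rw [show y - x₀ - (x - x₀) = -(x - y) by abel, norm_neg] at this
      rwa [show ρ₁ - ‖x - x₀‖ - (ρ₁ - ‖y - x₀‖) = ‖y - x₀‖ - ‖x - x₀‖ by ring]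
    calc _ = M / (ρ₁ - ρ₂) * |ρ₁ - ‖x - x₀‖ - (ρ₁ - ‖y - x₀‖)| := by ring
      _ ≤ _ := mul_le_mul_of_nonneg_left h (by positivity)

/-- the truncated kernel -/
def kap (N : ℕ) (s : ℝ) (z : E N) : ℝ := min (‖z‖ ^ 2) 1 * ‖z‖ ^ (-((N : ℝ) + 2 * s))

theorem kap_nonneg (N : ℕ) (s : ℝ) (z : E N) : 0 ≤ kap N s z := by unfold kap; positivity

theorem kap_integrable (N : ℕ) (hN : 2 ≤ N) (s : ℝ) (hs : s ∈ Ioo (0:ℝ) 1) :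
    Integrable (kap N s) := by
  have : Nonempty (Fin N) := ⟨⟨0, by omega⟩⟩
  have h := integrable_fun_norm_addHaar (E := E N) (volume : Measure (E N))
    (f := fun y : ℝ => min (y ^ 2) 1 * y ^ (-((N : ℝ) + 2 * s)))
  refine h.2 ?_
  simp only [finrank_euclideanSpace, Fintype.card_fin, smul_eq_mul]
  rw [← Ioc_union_Ioi_eq_Ioi (zero_le_one : (0:ℝ) ≤ 1)]
  obtain ⟨m, rfl⟩ : ∃ m, N = m + 1 := ⟨N - 1, by omega⟩
  apply IntegrableOn.union
  · have h1 : IntegrableOn (fun y : ℝ => y ^ (1 - 2 * s)) (Ioc 0 1) := by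
      rw [← intervalIntegrable_iff_integrableOn_Ioc_of_le zero_le_one]
      apply intervalIntegral.intervalIntegrable_rpow'
      have := hs.2; linarith
    apply h1.congr_fun _ measurableSet_Ioc
    intro y hy
    have hy0 : 0 < y := hy.1
    have : y ^ 2 ≤ 1 := by nlinarith [hy.1, hy.2]
    simp only [min_eq_left this, Nat.add_sub_cancel]
    rw [← Real.rpow_natCast, ← Real.rpow_natCast, ← Real.rpow_add hy0, ← Real.rpow_add hy0]
    congr 1; push_cast; ring
  · have h1 : IntegrableOn (fun y : ℝ => y ^ (-1 - 2 * s)) (Ioi 1) := by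
      apply integrableOn_Ioi_rpow_of_lt _ zero_lt_one
      have := hs.1; linarith
    apply h1.congr_fun _ measurableSet_Ioi
    intro y hy
    have hy1 : 1 < y := hy
    have hy0 : 0 < y := by linarith
    have : 1 ≤ y ^ 2 := by nlinarith
    simp only [min_eq_right this, Nat.add_sub_cancel, one_mul]
    rw [← Real.rpow_natCast, ← Real.rpow_add hy0]
    congr 1; push_cast; ring

theorem aux_global {F : Type*} [NormedAddCommGroup F] [NormedSpace ℝ F] [FiniteDimensional ℝ F]
    {V : F → ℝ} {D k : Set F} (hD : IsOpen D) (hk : IsCompact k) (hkD : k ⊆ D)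
    (hV : ContDiffOn ℝ (⊤ : ℕ∞) V D) (hpos : ∀ p ∈ D, 0 < V p) :
    ∃ (W : F → ℝ) (O : Set F), ContDiff ℝ (⊤ : ℕ∞) W ∧ (∀ p, 0 < W p) ∧ IsOpen O ∧ k ⊆ O ∧
      O ⊆ D ∧ ∀ p ∈ O, W p = V p := by
  -- shrink so that the support sits inside `D`
  obtain ⟨L, hL, hkL, hLD⟩ := exists_compact_between hk hD hkD
  obtain ⟨g, g1, g2, g3⟩ := exists_contMDiffMap_one_nhds_of_subset_interior
    (n := (⊤ : ℕ∞)) (modelWithCornersSelf ℝ F) (s := k) (t := L) hk.isClosed hkL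
  have hg : ContDiff ℝ (⊤ : ℕ∞) g := g.contMDiff.contDiff
  obtain ⟨O, hOo, hkO, hO⟩ := mem_nhdsSet_iff_exists.1 g1
  have hsub : O ⊆ L := by
    intro p hp
    by_contra h
    have e1 : g p = 1 := hO hp
    rw [g2 p h] at e1; exact zero_ne_one e1
  refine ⟨fun p => g p * V p + (1 - g p), O, ?_, ?_, hOo, hkO, hsub.trans hLD, ?_⟩
  · rw [contDiff_iff_contDiffAt]
    intro p
    apply ContDiffAt.add _ (contDiffAt_const.sub hg.contDiffAt)
    by_cases hp : p ∈ D
    · exact hg.contDiffAt.mul (hV.contDiffAt (hD.mem_nhds hp))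
    · have : (fun p => g p * V p) =ᶠ[nhds p] fun _ => 0 := by
        filter_upwards [hL.isClosed.isOpen_compl.mem_nhds (fun h => hp (hLD h))] with z hz
        rw [g2 z hz, zero_mul]
      exact contDiffAt_const.congr_of_eventuallyEq this
  · intro p
    have hg01 := g3 p
    by_cases hp : p ∈ D
    · have := hpos p hp
      rcases hg01.1.eq_or_lt with h | h
      · simp [← h]
      · have := mul_pos h this
        linarith [hg01.2]
    · have : g p = 0 := g2 p (fun h => hp (hLD h))
      simp [this]
  · intro p hp
    have : g p = 1 := hO hp
    simp [this]

theorem aux_iter_le {α : Type*} [MeasurableSpace α] {μ : Measure α} [SFinite μ] {F H : α → α → ℝ}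
    (hH : Integrable (fun p : α × α => H p.1 p.2) (μ.prod μ)) (h0 : ∀ x y, 0 ≤ H x y)
    (hle : ∀ x y, F x y ≤ H x y) :
    ∫ x, ∫ y, F x y ∂μ ∂μ ≤ ∫ p, H p.1 p.2 ∂(μ.prod μ) := by
  rw [integral_prod _ hH]
  apply aux_integral_le hH.integral_prod_left
  · exact Filter.Eventually.of_forall fun x => integral_nonneg fun y => h0 x y
  · filter_upwards [hH.prod_right_ae] with x hx
    exact aux_integral_le hx (Filter.Eventually.of_forall (h0 x)) (Filter.Eventually.of_forall (hle x))

theorem aux_pow (N : ℕ) (s : ℝ) (hs : s ∈ Ioo (0:ℝ) 1) (a b : ℝ) (hb : 0 < b) (h : b / 2 ≤ a) :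
    a ^ (-((N : ℝ) + 2 * s)) ≤ 2 ^ (N + 2) * b ^ (-((N : ℝ) + 2 * s)) := by
  have hs0 := hs.1
  have hs1 := hs.2
  have hN : (0:ℝ) ≤ N := Nat.cast_nonneg _
  calc a ^ (-((N : ℝ) + 2 * s)) ≤ (b / 2) ^ (-((N : ℝ) + 2 * s)) :=
        Real.rpow_le_rpow_of_nonpos (by positivity) h (by linarith)
    _ = 2 ^ ((N : ℝ) + 2 * s) * b ^ (-((N : ℝ) + 2 * s)) := by
        rw [Real.div_rpow hb.le (by norm_num), Real.rpow_neg (by norm_num : (0:ℝ) ≤ 2)]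
        field_simp
    _ ≤ _ := by
        apply mul_le_mul_of_nonneg_right _ (by positivity)
        rw [← Real.rpow_natCast]
        apply Real.rpow_le_rpow_of_exponent_le (by norm_num)
        push_cast; linarith

theorem aux_int4 {α : Type*} [MeasurableSpace α] {μ : Measure α} {f1 f2 f3 f4 : α → ℝ}
    {c1 c2 c3 c4 : ℝ} (h1 : Integrable f1 μ) (h2 : Integrable f2 μ) (h3 : Integrable f3 μ)
    (h4 : Integrable f4 μ) :
    ∫ x, (c1 * f1 x + c2 * f2 x + c3 * f3 x + c4 * f4 x) ∂μ =
      c1 * ∫ x, f1 x ∂μ + c2 * ∫ x, f2 x ∂μ + c3 * ∫ x, f3 x ∂μ + c4 * ∫ x, f4 x ∂μ := by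
  have e1 := h1.const_mul c1
  have e2 := h2.const_mul c2
  have e3 := h3.const_mul c3
  have e4 := h4.const_mul c4
  rw [integral_add (by exact (e1.add e2).add e3) e4, integral_add (by exact e1.add e2) e3,
    integral_add e1 e2]
  simp only [integral_const_mul]

theorem nl_bound (N : ℕ) (hN : 2 ≤ N) (s Λ : ℝ) (hs : s ∈ Ioo (0:ℝ) 1) (hΛ : 1 ≤ Λ)
    (k : E N → E N → ℝ) (U V ψ : E N → ℝ) (x₀ : E N) (R r ρ l q L M : ℝ)
    (hks : ∀ x y, k x y = k y x) (hk0 : ∀ x y, x ≠ y → 0 ≤ k x y)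
    (hk1 : ∀ x y, x ≠ y → k x y ≤ Λ * ‖x - y‖ ^ (-((N : ℝ) + 2 * s)))
    (hUm : Measurable U) (hUM : ∀ x, |U x| ≤ M)
    (hU0 : ∀ x ∈ ball x₀ R, 0 ≤ U x) (hV : Continuous V) (hVpos : ∀ x, 0 < V x)
    (hVU : ∀ x ∈ closedBall x₀ ρ, V x = U x + l) (hl : 0 < l)
    (hr : 0 < r) (hρ : ρ ≤ r) (hR : r < R / 2) (hq : 0 < q) (hL1 : 1 ≤ L) (hLr : 1 / r ≤ L)
    (hψ0 : ∀ x, 0 ≤ ψ x) (hψ1 : ∀ x, ψ x ≤ 1) (hψs : ∀ x, x ∉ closedBall x₀ ρ → ψ x = 0)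
    (hψL : ∀ x y, |ψ x - ψ y| ≤ L * ‖x - y‖)
    (htail : ∫ y in (ball x₀ R)ᶜ, |max (-(U y)) 0| * ‖y - x₀‖ ^ (-((N : ℝ) + 2 * s)) ≤ l / r ^ 2) :
    ∫ x, ∫ y, (U x - U y) * (ψ x ^ 2 * V x ^ (-(q+1)) - ψ y ^ 2 * V y ^ (-(q+1))) * k x y ≤
      (Λ * (4 * (∫ z, kap N s z) + 2 ^ (N + 3))) * L ^ 2 * ∫ x in closedBall x₀ ρ, V x ^ (-q) := by
  set W : E N → ℝ := indicator (closedBall x₀ ρ) (fun x => V x ^ (-q)) with hW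
  set m : E N → ℝ := indicator (ball x₀ R)ᶜ
    (fun y => |max (-(U y)) 0| * ‖y - x₀‖ ^ (-((N : ℝ) + 2 * s))) with hm
  have hR0 : 0 < R := by linarith
  have hVq : Continuous fun x => V x ^ (-q) :=
    hV.rpow_const fun x => Or.inl (hVpos x).ne'
  have hWint : Integrable W := by
    rw [hW, integrable_indicator_iff measurableSet_closedBall]
    exact hVq.continuousOn.integrableOn_compact (isCompact_closedBall _ _)
  have hW0 : ∀ x, 0 ≤ W x := fun x =>
    indicator_nonneg (fun x _ => Real.rpow_nonneg (hVpos x).le _) x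
  have hm0 : ∀ x, 0 ≤ m x := fun x => indicator_nonneg (fun x _ => by positivity) x
  have hkap := kap_integrable N hN s hs
  have hM0 : 0 ≤ M := (abs_nonneg _).trans (hUM x₀)
  have hmint : Integrable m := by
    have h1 : Integrable (fun y => (M * max 1 (R ^ 2)⁻¹) * kap N s (y - x₀)) :=
      (hkap.comp_sub_right x₀).const_mul _
    refine h1.mono' ?_ ?_
    · apply Measurable.aestronglyMeasurable
      apply Measurable.indicator _ measurableSet_ball.compl
      fun_prop
    · refine Filter.Eventually.of_forall fun y => ?_
      rw [Real.norm_of_nonneg (hm0 y)]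
      by_cases hy : y ∈ (ball x₀ R)ᶜ
      · rw [hm, indicator_of_mem hy]
        have hyR : R ≤ ‖y - x₀‖ := by
          rw [mem_compl_iff, mem_ball, dist_eq_norm, not_lt] at hy; exact hy
        have a1 : |max (-(U y)) 0| ≤ M := by
          rw [abs_of_nonneg (le_max_right _ _)]
          exact max_le ((neg_le_abs _).trans (hUM y)) hM0
        have a2 : 1 ≤ max 1 (R ^ 2)⁻¹ * min (‖y - x₀‖ ^ 2) 1 := by
          rcases le_total (‖y - x₀‖ ^ 2) 1 with h | h
          · rw [min_eq_left h]
            calc (1:ℝ) = (R ^ 2)⁻¹ * R ^ 2 := by field_simp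
              _ ≤ _ := by
                apply mul_le_mul (le_max_right _ _) _ (by positivity) (by positivity)
                gcongr
          · rw [min_eq_right h, mul_one]; exact le_max_left _ _
        unfold kap
        calc _ ≤ M * ‖y - x₀‖ ^ (-((N : ℝ) + 2 * s)) :=
              mul_le_mul_of_nonneg_right a1 (by positivity)
          _ = M * 1 * ‖y - x₀‖ ^ (-((N : ℝ) + 2 * s)) := by ring
          _ ≤ M * (max 1 (R ^ 2)⁻¹ * min (‖y - x₀‖ ^ 2) 1) * ‖y - x₀‖ ^ (-((N : ℝ) + 2 * s)) := by
              gcongr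
          _ = _ := by ring
      · rw [hm, indicator_of_notMem hy]
        have := kap_nonneg N s (y - x₀)
        positivity
  have hmI : ∫ y, m y ≤ l / r ^ 2 := by
    rw [hm, integral_indicator measurableSet_ball.compl]; exact htail
  have hWI : ∫ x in closedBall x₀ ρ, V x ^ (-q) = ∫ x, W x := by
    rw [hW, integral_indicator measurableSet_closedBall]
  rw [hWI]
  -- pointwise bounds
  have hκ : ∀ x y, x ≠ y → (ψ x - ψ y) ^ 2 * k x y ≤ Λ * L ^ 2 * kap N s (x - y) := by
    intro x y hxy
    have b1 : (ψ x - ψ y) ^ 2 ≤ L ^ 2 * min (‖x - y‖ ^ 2) 1 := by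
      have c1 : (ψ x - ψ y) ^ 2 ≤ L ^ 2 * ‖x - y‖ ^ 2 := by
        rw [← mul_pow, ← sq_abs]; exact pow_le_pow_left₀ (abs_nonneg _) (hψL x y) 2
      have c2 : (ψ x - ψ y) ^ 2 ≤ L ^ 2 * 1 := by
        have : |ψ x - ψ y| ≤ 1 := abs_le.2 ⟨by linarith [hψ0 x, hψ1 y], by linarith [hψ0 y, hψ1 x]⟩
        have : (ψ x - ψ y) ^ 2 ≤ 1 := by rw [← sq_abs]; exact pow_le_one₀ (abs_nonneg _) this
        nlinarith
      rcases le_total (‖x - y‖ ^ 2) 1 with h | h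
      · rwa [min_eq_left h]
      · rwa [min_eq_right h]
    unfold kap
    calc _ ≤ (L ^ 2 * min (‖x - y‖ ^ 2) 1) * (Λ * ‖x - y‖ ^ (-((N : ℝ) + 2 * s))) :=
          mul_le_mul b1 (hk1 x y hxy) (hk0 x y hxy) (by positivity)
      _ = _ := by ring
  have htl : ∀ x y, x ∈ closedBall x₀ ρ → y ∉ closedBall x₀ ρ →
      max (-(U y)) 0 * k x y ≤ Λ * 2 ^ (N + 2) * m y := by
    intro x y hx hy
    by_cases hyR : y ∈ ball x₀ R
    · have : max (-(U y)) 0 = 0 := max_eq_right (by linarith [hU0 y hyR])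
      rw [this, zero_mul]; have := hm0 y; positivity
    · rw [hm, indicator_of_mem (show y ∈ (ball x₀ R)ᶜ from hyR)]
      rw [abs_of_nonneg (le_max_right _ _)]
      have hxy : x ≠ y := fun h => hy (h ▸ hx)
      rw [mem_closedBall, dist_eq_norm] at hx
      rw [mem_ball, dist_eq_norm, not_lt] at hyR
      have d1 : ‖y - x₀‖ / 2 ≤ ‖x - y‖ := by
        have : ‖y - x₀‖ ≤ ‖x - y‖ + ‖x - x₀‖ := by
          rw [show y - x₀ = -(x - y) + (x - x₀) by abel]
          exact (norm_add_le _ _).trans (by rw [norm_neg])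
        linarith
      have d2 := aux_pow N s hs _ _ (by linarith) d1
      calc _ ≤ max (-(U y)) 0 * (Λ * (2 ^ (N + 2) * ‖y - x₀‖ ^ (-((N : ℝ) + 2 * s)))) := by
            gcongr
            exact (hk1 x y hxy).trans (by gcongr)
        _ = _ := by ring
  -- one sided estimate
  have hone : ∀ x y, x ∈ closedBall x₀ ρ → y ∉ closedBall x₀ ρ →
      (U x - U y) * (ψ x ^ 2 * V x ^ (-(q+1))) * k x y ≤
        Λ * L ^ 2 * (W x * kap N s (x - y)) + Λ * 2 ^ (N + 2) * l⁻¹ * (W x * m y) := by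
    intro x y hx hy
    have hxy : x ≠ y := fun h => hy (h ▸ hx)
    have hWx : W x = V x ^ (-q) := by rw [hW, indicator_of_mem hx]
    have hUx : U x = V x - l := by rw [hVU x hx]; ring
    have hVl : l ≤ V x := by
      rw [hVU x hx]
      have := hU0 x (closedBall_subset_ball (by linarith) hx)
      linarith
    have e1 : V x ^ (-q) = V x ^ (-(q+1)) * V x := by
      rw [← Real.rpow_add_one (hVpos x).ne']; congr 1; ring
    have hk := hk0 x y hxy
    have p1 : 0 < V x ^ (-(q+1)) := Real.rpow_pos_of_pos (hVpos x) _
    have f1 : U x - U y ≤ V x + max (-(U y)) 0 := by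
      have := le_max_left (-(U y)) 0
      linarith
    have f2 : V x ^ (-(q+1)) ≤ l⁻¹ * W x := by
      rw [hWx, e1, inv_mul_eq_div, le_div_iff₀ hl]
      exact mul_le_mul_of_nonneg_left hVl p1.le
    have f3 := hκ x y hxy
    rw [hψs y hy, sub_zero] at f3
    have f4 := htl x y hx hy
    have f5 : ψ x ^ 2 ≤ 1 := pow_le_one₀ (hψ0 x) (hψ1 x)
    have g1 : 0 ≤ max (-(U y)) 0 * k x y := mul_nonneg (le_max_right _ _) hk
    calc (U x - U y) * (ψ x ^ 2 * V x ^ (-(q+1))) * k x y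
        ≤ (V x + max (-(U y)) 0) * (ψ x ^ 2 * V x ^ (-(q+1))) * k x y := by
          gcongr
      _ = W x * (ψ x ^ 2 * k x y) + ψ x ^ 2 * (V x ^ (-(q+1)) * (max (-(U y)) 0 * k x y)) := by
          rw [hWx, e1]; ring
      _ ≤ W x * (Λ * L ^ 2 * kap N s (x - y)) + 1 * ((l⁻¹ * W x) * (Λ * 2 ^ (N + 2) * m y)) := by
          have := hW0 x
          gcongr
      _ = _ := by ring
  set H : E N → E N → ℝ := fun x y =>
    2 * Λ * L ^ 2 * (W x * kap N s (x - y)) + 2 * Λ * L ^ 2 * (W y * kap N s (x - y)) +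
    Λ * 2 ^ (N + 2) * l⁻¹ * (W x * m y) + Λ * 2 ^ (N + 2) * l⁻¹ * (m x * W y) with hH
  have hΛ0 : 0 ≤ Λ := by linarith
  have hH0 : ∀ x y, 0 ≤ H x y := by
    intro x y
    have := hW0 x; have := hW0 y; have := hm0 x; have := hm0 y; have := kap_nonneg N s (x - y)
    simp only [hH]; positivity
  have kapsym : ∀ x y : E N, kap N s (x - y) = kap N s (y - x) := by
    intro x y; unfold kap; rw [norm_sub_rev]
  have hFH : ∀ x y, (U x - U y) * (ψ x ^ 2 * V x ^ (-(q+1)) - ψ y ^ 2 * V y ^ (-(q+1))) * k x y ≤ H x y := by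
    intro x y
    by_cases hxy : x = y
    · subst hxy; simp only [sub_self, zero_mul]; exact hH0 x x
    have := hW0 x; have := hW0 y; have := hm0 x; have := hm0 y; have := kap_nonneg N s (x - y)
    by_cases hx : x ∈ closedBall x₀ ρ <;> by_cases hy : y ∈ closedBall x₀ ρ
    · have hWx : W x = V x ^ (-q) := by rw [hW, indicator_of_mem hx]
      have hWy : W y = V y ^ (-q) := by rw [hW, indicator_of_mem hy]
      have f1 := aux_alg (hVpos x) (hVpos y) hq (hψ0 x) (hψ0 y)
      rw [← hWx, ← hWy] at f1
      have f2 := mul_le_mul_of_nonneg_right f1 (hk0 x y hxy)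
      have f3 := mul_le_mul_of_nonneg_left (hκ x y hxy) (by positivity : 0 ≤ 2 * (W x + W y))
      have f4 : 0 ≤ Λ * 2 ^ (N + 2) * l⁻¹ * (W x * m y) := by positivity
      have f5 : 0 ≤ Λ * 2 ^ (N + 2) * l⁻¹ * (m x * W y) := by positivity
      have f6 : U x - U y = V x - V y := by rw [hVU x hx, hVU y hy]; ring
      rw [f6]
      simp only [hH]
      linarith
    · rw [hψs y hy]
      have := hone x y hx hy
      have f3 : 0 ≤ Λ * L ^ 2 * (W x * kap N s (x - y)) := by positivity
      have f4 : 0 ≤ 2 * Λ * L ^ 2 * (W y * kap N s (x - y)) := by positivity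
      have f5 : 0 ≤ Λ * 2 ^ (N + 2) * l⁻¹ * (m x * W y) := by positivity
      simp only [hH]
      linarith
    · rw [hψs x hx]
      have := hone y x hy hx
      rw [kapsym y x, ← hks x y] at this
      have f3 : 0 ≤ Λ * L ^ 2 * (W y * kap N s (x - y)) := by positivity
      have f4 : 0 ≤ 2 * Λ * L ^ 2 * (W x * kap N s (x - y)) := by positivity
      have f5 : 0 ≤ Λ * 2 ^ (N + 2) * l⁻¹ * (W x * m y) := by positivity
      simp only [hH]
      linarith
    · rw [hψs x hx, hψs y hy]; simpa using hH0 x y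
  have hi1 : Integrable (fun p : E N × E N => W p.2 * kap N s (p.1 - p.2)) (volume.prod volume) :=
    hWint.convolution_integrand (ContinuousLinearMap.mul ℝ ℝ) hkap
  have hi2 : Integrable (fun p : E N × E N => W p.1 * kap N s (p.1 - p.2)) (volume.prod volume) := by
    refine hi1.swap.congr (Filter.Eventually.of_forall fun p => ?_)
    simp only [Function.comp, Prod.fst_swap, Prod.snd_swap]
    rw [kapsym]
  have hi3 : Integrable (fun p : E N × E N => W p.1 * m p.2) (volume.prod volume) :=
    hWint.mul_prod hmint
  have hi4 : Integrable (fun p : E N × E N => m p.1 * W p.2) (volume.prod volume) :=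
    hmint.mul_prod hWint
  have hHint : Integrable (fun p : E N × E N => H p.1 p.2) (volume.prod volume) :=
    (((hi2.const_mul _).add (hi1.const_mul _)).add (hi3.const_mul _)).add (hi4.const_mul _)
  refine (aux_iter_le hHint hH0 hFH).trans ?_
  have hsum : ∫ p : E N × E N, H p.1 p.2 ∂(volume.prod volume) =
      2 * Λ * L ^ 2 * ((∫ x, W x) * ∫ z, kap N s z) + 2 * Λ * L ^ 2 * ((∫ x, W x) * ∫ z, kap N s z)
      + Λ * 2 ^ (N + 2) * l⁻¹ * ((∫ x, W x) * ∫ x, m x) +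
      Λ * 2 ^ (N + 2) * l⁻¹ * ((∫ x, m x) * ∫ x, W x) := by
    simp only [hH]
    rw [aux_int4 hi2 hi1 hi3 hi4, integral_prod_mul, integral_prod_mul,
      integral_prod _ hi2, integral_prod_symm _ hi1]
    simp only [integral_const_mul, integral_sub_left_eq_self (kap N s), integral_sub_right_eq_self (kap N s), integral_mul_const]
  rw [hsum]
  have hWI0 : 0 ≤ ∫ x, W x := integral_nonneg hW0
  have h1 : l⁻¹ * ∫ x, m x ≤ L ^ 2 := by
    calc l⁻¹ * ∫ x, m x ≤ l⁻¹ * (l / r ^ 2) := by gcongr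
      _ = (1 / r) ^ 2 := by field_simp
      _ ≤ _ := by gcongr
  have h2 := mul_le_mul_of_nonneg_left h1 (by positivity : 0 ≤ Λ * 2 ^ (N + 3) * ∫ x, W x)
  have e : (2:ℝ) ^ (N + 3) = 2 * 2 ^ (N+2) := by ring
  rw [e] at h2 ⊢
  nlinarith

theorem k_integrableOn (N : ℕ) (hN : 2 ≤ N) (s : ℝ) (hs : s ∈ Ioo (0:ℝ) 1) (x₀ : E N) (R : ℝ)
    (hR0 : 0 < R) :
    IntegrableOn (fun y : E N => ‖y - x₀‖ ^ (-((N : ℝ) + 2 * s))) (ball x₀ R)ᶜ := by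
  have h1 : Integrable (fun y => (max 1 (R ^ 2)⁻¹) * kap N s (y - x₀)) :=
    ((kap_integrable N hN s hs).comp_sub_right x₀).const_mul _
  refine h1.integrableOn.mono' ?_ ?_
  · apply Measurable.aestronglyMeasurable
    fun_prop
  · refine (ae_restrict_iff' measurableSet_ball.compl).2 (Filter.Eventually.of_forall fun y hy => ?_)
    rw [Real.norm_of_nonneg (by positivity)]
    have hyR : R ≤ ‖y - x₀‖ := by
      rw [mem_compl_iff, mem_ball, dist_eq_norm, not_lt] at hy; exact hy
    have a2 : 1 ≤ max 1 (R ^ 2)⁻¹ * min (‖y - x₀‖ ^ 2) 1 := by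
      rcases le_total (‖y - x₀‖ ^ 2) 1 with h | h
      · rw [min_eq_left h]
        calc (1:ℝ) = (R ^ 2)⁻¹ * R ^ 2 := by field_simp
          _ ≤ _ := by
            apply mul_le_mul (le_max_right _ _) _ (by positivity) (by positivity)
            gcongr
      · rw [min_eq_right h, mul_one]; exact le_max_left _ _
    unfold kap
    calc _ = 1 * ‖y - x₀‖ ^ (-((N : ℝ) + 2 * s)) := by ring
      _ ≤ (max 1 (R ^ 2)⁻¹ * min (‖y - x₀‖ ^ 2) 1) * ‖y - x₀‖ ^ (-((N : ℝ) + 2 * s)) := by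
          gcongr
      _ = _ := by ring

theorem tail_nonneg (N : ℕ) (s : ℝ) (w : E N → ℝ → ℝ) (x₀ : E N) (R a b : ℝ) (hab : a < b) :
    0 ≤ essSup
      (fun t => ∫ y in (Metric.ball x₀ R)ᶜ, |w y t| * ‖y - x₀‖ ^ (-((N : ℝ) + 2 * s)))
      (volume.restrict (Set.Ioo a b)) := by
  unfold essSup
  rw [Filter.limsup_eq]
  apply Real.sInf_nonneg
  intro c hc
  have : (ae (volume.restrict (Ioo a b))).NeBot := by
    rw [ae_neBot]
    intro h
    rw [Measure.restrict_eq_zero, Real.volume_Ioo, ENNReal.ofReal_eq_zero] at h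
    linarith
  rw [mem_ofPred_eq] at hc
  obtain ⟨t, ht⟩ := hc.exists
  refine le_trans ?_ ht
  exact integral_nonneg fun y => by positivity

theorem tail_ae (N : ℕ) (hN : 2 ≤ N) (s : ℝ) (hs : s ∈ Ioo (0:ℝ) 1) (T M : ℝ)
    (u : E N → ℝ → ℝ) (x₀ : E N) (R r t₀ d l : ℝ) (hR0 : 0 < R) (hr : 0 < r) (hd : 0 < d)
    (hM : ∀ x t, t ∈ Ioo 0 T → |u x t| ≤ M)
    (hI : Ioo (t₀ - r ^ 2) t₀ ⊆ Ioo 0 T)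
    (hl : (r / R) ^ 2 * tailInfty N s (uminus N u) x₀ R (t₀ - r ^ 2) t₀ + d ≤ l) :
    d ≤ l ∧ ∀ᵐ t : ℝ, t ∈ Ioo (t₀ - r ^ 2) t₀ →
      ∫ y in (ball x₀ R)ᶜ, |max (-(u y t)) 0| * ‖y - x₀‖ ^ (-((N : ℝ) + 2 * s)) ≤ l / r ^ 2 := by
  unfold tailInfty at hl
  set S := essSup (fun t => ∫ y in (Metric.ball x₀ R)ᶜ, |uminus N u y t| * ‖y - x₀‖ ^ (-((N : ℝ) + 2 * s)))
      (volume.restrict (Set.Ioo (t₀ - r ^ 2) t₀)) with hS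
  have hS0 : 0 ≤ S := tail_nonneg N s _ x₀ R _ _ (by nlinarith)
  have e : (r / R) ^ 2 * (R ^ 2 * S) = r ^ 2 * S := by field_simp
  rw [e] at hl
  have h1 : 0 ≤ r ^ 2 * S := by positivity
  refine ⟨by linarith, ?_⟩
  rw [← ae_restrict_iff' measurableSet_Ioo]
  have hk := k_integrableOn N hN s hs x₀ R hR0
  have hb : ∀ᵐ t ∂(volume.restrict (Set.Ioo (t₀ - r ^ 2) t₀)),
      (∫ y in (Metric.ball x₀ R)ᶜ, |uminus N u y t| * ‖y - x₀‖ ^ (-((N : ℝ) + 2 * s))) ≤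
      ∫ y in (Metric.ball x₀ R)ᶜ, M * ‖y - x₀‖ ^ (-((N : ℝ) + 2 * s)) := by
    refine (ae_restrict_iff' measurableSet_Ioo).2 (Filter.Eventually.of_forall fun t ht => ?_)
    have hM0 : 0 ≤ M := (abs_nonneg _).trans (hM x₀ t (hI ht))
    apply aux_integral_le (hk.const_mul M)
    · exact Filter.Eventually.of_forall fun y => by
        show (0:ℝ) ≤ M * ‖y - x₀‖ ^ (-((N : ℝ) + 2 * s))
        positivity
    · refine Filter.Eventually.of_forall fun y => mul_le_mul_of_nonneg_right ?_ (by positivity)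
      unfold uminus
      rw [abs_of_nonneg (le_max_right _ _)]
      exact max_le ((neg_le_abs _).trans (hM y t (hI ht))) hM0
  have h2 := ae_le_essSup (f := fun t => ∫ y in (Metric.ball x₀ R)ᶜ, |uminus N u y t| * ‖y - x₀‖ ^ (-((N : ℝ) + 2 * s)))
    (μ := (volume.restrict (Set.Ioo (t₀ - r ^ 2) t₀))) ⟨_, Filter.eventually_map.2 hb⟩
  filter_upwards [h2] with t ht
  unfold uminus at ht
  refine ht.trans ?_
  rw [le_div_iff₀ (by positivity)]
  have : S * r ^ 2 ≤ l := by linarith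
  exact this

/-- time derivative -/
def dT {N : ℕ} (V : E N × ℝ → ℝ) (p : E N × ℝ) : ℝ := fderiv ℝ V p (0, 1)

/-- space derivative -/
def dX {N : ℕ} (V : E N × ℝ → ℝ) (p : E N × ℝ) : E N →L[ℝ] ℝ :=
  (fderiv ℝ V p).comp (ContinuousLinearMap.inl ℝ (E N) ℝ)

theorem dT_cont {N : ℕ} {V : E N × ℝ → ℝ} (hV : ContDiff ℝ (⊤ : ℕ∞) V) : Continuous (dT V) := by
  have : Continuous (fderiv ℝ V) := hV.continuous_fderiv (by simp)
  unfold dT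
  fun_prop

theorem dX_cont {N : ℕ} {V : E N × ℝ → ℝ} (hV : ContDiff ℝ (⊤ : ℕ∞) V) : Continuous (dX V) := by
  have : Continuous (fderiv ℝ V) := hV.continuous_fderiv (by simp)
  unfold dX
  fun_prop

theorem dT_has {N : ℕ} {V : E N × ℝ → ℝ} (hV : ContDiff ℝ (⊤ : ℕ∞) V) (x : E N) (t : ℝ) :
    HasDerivAt (fun τ => V (x, τ)) (dT V (x, t)) t := by
  have h1 : HasFDerivAt V (fderiv ℝ V (x, t)) (x, t) :=
    (hV.differentiable (by simp) _).hasFDerivAt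
  have h2 : HasDerivAt (fun τ : ℝ => (x, τ)) ((0 : E N), (1:ℝ)) t :=
    (hasDerivAt_const t x).prodMk (hasDerivAt_id t)
  exact h1.comp_hasDerivAt t h2

theorem dX_has {N : ℕ} {V : E N × ℝ → ℝ} (hV : ContDiff ℝ (⊤ : ℕ∞) V) (x : E N) (t : ℝ) :
    HasFDerivAt (fun y => V (y, t)) (dX V (x, t)) x := by
  have h1 : HasFDerivAt V (fderiv ℝ V (x, t)) (x, t) :=
    (hV.differentiable (by simp) _).hasFDerivAt
  exact h1.comp x (hasFDerivAt_prodMk_left x t)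

/-- space gradient -/
def gX {N : ℕ} (V : E N × ℝ → ℝ) (p : E N × ℝ) : E N :=
  (InnerProductSpace.toDual ℝ (E N)).symm (dX V p)

theorem gX_cont {N : ℕ} {V : E N × ℝ → ℝ} (hV : ContDiff ℝ (⊤ : ℕ∞) V) : Continuous (gX V) :=
  (InnerProductSpace.toDual ℝ (E N)).symm.continuous.comp (dX_cont hV)

theorem gX_norm {N : ℕ} (V : E N × ℝ → ℝ) (p : E N × ℝ) : ‖gX V p‖ = ‖dX V p‖ :=
  (InnerProductSpace.toDual ℝ (E N)).symm.norm_map _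

theorem dX_gX {N : ℕ} (V : E N × ℝ → ℝ) (p : E N × ℝ) : dX V p (gX V p) = ‖dX V p‖ ^ 2 := by
  rw [← gX_norm, ← real_inner_self_eq_norm_sq]
  conv_rhs => rw [gX]
  rw [InnerProductSpace.toDual_symm_apply]
  rfl

theorem inner_grad {N : ℕ} (f g : E N → ℝ) (x : E N) (f' g' : E N →L[ℝ] ℝ)
    (hf : fderiv ℝ f x = f') (hg : fderiv ℝ g x = g') :
    ⟪gradient f x, gradient g x⟫ = g' ((InnerProductSpace.toDual ℝ (E N)).symm f') := by
  unfold gradient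
  rw [real_inner_comm, InnerProductSpace.toDual_symm_apply, hf, hg]

theorem cs_support {N : ℕ} (G : E N × ℝ → ℝ) (x₀ : E N) (ρ : ℝ) (k : Set ℝ) (hk : IsCompact k)
    (h : ∀ x t, x ∉ closedBall x₀ ρ ∨ t ∉ k → G (x, t) = 0) :
    HasCompactSupport G ∧ tsupport G ⊆ closedBall x₀ ρ ×ˢ k := by
  have hc : IsCompact (closedBall x₀ ρ ×ˢ k) := (isCompact_closedBall _ _).prod hk
  constructor
  · apply HasCompactSupport.intro hc
    rintro ⟨x, t⟩ hx
    apply h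
    by_contra hcon
    push Not at hcon
    exact hx hcon
  · apply closure_minimal _ hc.isClosed
    rintro ⟨x, t⟩ hx
    by_contra hcon
    apply hx
    apply h
    by_contra h2
    push Not at h2
    exact hcon h2

theorem int_prod_swap {N : ℕ} (G : E N × ℝ → ℝ) (hG : Continuous G) (hs : HasCompactSupport G) :
    ∫ t, ∫ x, G (x, t) = ∫ x, ∫ t, G (x, t) := by
  have : Integrable (Function.uncurry fun x t => G (x, t)) ((volume : Measure (E N)).prod volume) :=
    hG.integrable_of_hasCompactSupport hs
  exact (integral_integral_swap this).symm

theorem par_cont {N : ℕ} (G : E N × ℝ → ℝ) (hG : Continuous G) (x₀ : E N) (ρ : ℝ)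
    (h : ∀ x t, x ∉ closedBall x₀ ρ → G (x, t) = 0) : Continuous fun t => ∫ x, G (x, t) := by
  rw [← continuousOn_univ]
  apply continuousOn_integral_of_compact_support (f := fun t x => G (x, t)) (isCompact_closedBall x₀ ρ)
  · apply Continuous.continuousOn
    exact hG.comp continuous_swap
  · intro p x _ hx; exact h x p hx

theorem slice_x {N : ℕ} (G : E N × ℝ → ℝ) (hG : Continuous G) (x₀ : E N) (ρ : ℝ)
    (h : ∀ x t, x ∉ closedBall x₀ ρ → G (x, t) = 0) (t : ℝ) : Integrable fun x => G (x, t) := by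
  apply Continuous.integrable_of_hasCompactSupport (by fun_prop)
  exact HasCompactSupport.intro (isCompact_closedBall x₀ ρ) fun x hx => h x t hx

/-- integration by parts in time -/
theorem ibp_time {N : ℕ} {V : E N × ℝ → ℝ} (hV : ContDiff ℝ (⊤ : ℕ∞) V) {φ φt : E N × ℝ → ℝ}
    (hφ : Continuous φ) (hφt : Continuous φt) (hd : ∀ x t, HasDerivAt (fun τ => φ (x, τ)) (φt (x, t)) t)
    (x₀ : E N) (ρ l : ℝ) (k : Set ℝ) (hk : IsCompact k)
    (h : ∀ x t, x ∉ closedBall x₀ ρ ∨ t ∉ k → φ (x, t) = 0)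
    (h' : ∀ x t, x ∉ closedBall x₀ ρ ∨ t ∉ k → φt (x, t) = 0) :
    -(∫ t, ∫ x, (V (x, t) - l) * φt (x, t)) = ∫ t, ∫ x, φ (x, t) * dT V (x, t) := by
  have hVc := hV.continuous
  have hTc := dT_cont hV
  have s1 := (cs_support (fun p => (V p - l) * φt p) x₀ ρ k hk
    (fun x t hx => by simp [h' x t hx])).1
  have s2 := (cs_support (fun p => φ p * dT V p) x₀ ρ k hk
    (fun x t hx => by simp [h x t hx])).1
  have c1 : Continuous (fun p => (V p - l) * φt p) := by fun_prop
  have c2 : Continuous (fun p => φ p * dT V p) := by fun_prop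
  have i1 := c1.integrable_of_hasCompactSupport s1 (μ := (volume : Measure (E N)).prod volume)
  have i2 := c2.integrable_of_hasCompactSupport s2 (μ := (volume : Measure (E N)).prod volume)
  have e1 := int_prod_swap _ c1 s1
  have e2 := int_prod_swap _ c2 s2
  rw [e1, e2]
  rw [neg_eq_iff_add_eq_zero]
  rw [← integral_add i1.integral_prod_left i2.integral_prod_left]
  apply integral_eq_zero_of_ae
  refine Filter.Eventually.of_forall fun x => ?_
  have j1 : Integrable (fun t => (V (x, t) - l) * φt (x, t)) := by
    apply Continuous.integrable_of_hasCompactSupport (by fun_prop)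
    exact HasCompactSupport.intro hk fun t ht => by simp [h' x t (Or.inr ht)]
  have j2 : Integrable (fun t => φ (x, t) * dT V (x, t)) := by
    apply Continuous.integrable_of_hasCompactSupport (by fun_prop)
    exact HasCompactSupport.intro hk fun t ht => by simp [h x t (Or.inr ht)]
  have j3 : Integrable (fun t => (V (x, t) - l) * φ (x, t)) := by
    apply Continuous.integrable_of_hasCompactSupport (by fun_prop)
    exact HasCompactSupport.intro hk fun t ht => by simp [h x t (Or.inr ht)]
  show (∫ t, (V (x, t) - l) * φt (x, t)) + (∫ t, φ (x, t) * dT V (x, t)) = 0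
  rw [← integral_add j1 j2]
  refine integral_eq_zero_of_hasDerivAt_of_integrable (f := fun t => (V (x, t) - l) * φ (x, t))
    (fun t => ?_) (j1.add j2) j3
  have := ((dT_has hV x t).sub_const l).mul (hd x t)
  exact this.congr_deriv (by ring)

/-- the local gradient term -/
def gradTerm {N : ℕ} (V : E N × ℝ → ℝ) (ψ : E N → ℝ) (q : ℝ) (p : E N × ℝ) : ℝ :=
  -(q+1) * (ψ p.1 ^ 2 * V p ^ (-(q+2)) * ‖dX V p‖ ^ 2) +
    2 * V p ^ (-(q+1)) * ψ p.1 * fderiv ℝ ψ p.1 (gX V p)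

theorem gradTerm_le {N : ℕ} (V : E N × ℝ → ℝ) (hpos : ∀ p, 0 < V p) (ψ : E N → ℝ) (q L : ℝ) (hq : 0 < q)
    (hψ0 : ∀ x, 0 ≤ ψ x) (hψL : ∀ x, ‖fderiv ℝ ψ x‖ ≤ L) (p : E N × ℝ) :
    gradTerm V ψ q p ≤ -((q+1)/2) * (ψ p.1 ^ 2 * V p ^ (-(q+2)) * ‖dX V p‖ ^ 2) +
      2 * L ^ 2 * V p ^ (-q) := by
  unfold gradTerm
  have hp := hpos p
  set A := V p ^ (-(q+2)) with hA
  have hApos : 0 < A := Real.rpow_pos_of_pos hp _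
  have e1 : V p ^ (-(q+1)) = A * V p := by
    rw [hA, ← Real.rpow_add_one hp.ne']; congr 1; ring
  have e2 : V p ^ (-q) = A * V p ^ 2 := by
    rw [hA, ← Real.rpow_natCast, ← Real.rpow_add hp]; congr 1; push_cast; ring
  rw [e1, e2]
  have h1 : fderiv ℝ ψ p.1 (gX V p) ≤ L * ‖dX V p‖ := by
    rw [← gX_norm]
    exact (le_abs_self _).trans ((ContinuousLinearMap.le_opNorm _ _).trans
      (mul_le_mul_of_nonneg_right (hψL _) (norm_nonneg _)))
  have hψ := hψ0 p.1
  set g := ‖dX V p‖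
  have h2 : 2 * (A * V p) * ψ p.1 * fderiv ℝ ψ p.1 (gX V p) ≤ 2 * (A * V p) * ψ p.1 * (L * g) := by
    gcongr
  have h3 : 2 * (A * V p) * ψ p.1 * (L * g) ≤ (1/2) * (ψ p.1 ^ 2 * A * g ^ 2) + 2 * L ^ 2 * (A * V p ^ 2) := by
    have := mul_nonneg hApos.le (sq_nonneg (ψ p.1 * g - 2 * L * V p))
    nlinarith
  have h4 : 0 ≤ ψ p.1 ^ 2 * A * g ^ 2 := by positivity
  nlinarith

/-- constant of the slice inequality -/
def C1 (N : ℕ) (s Λ : ℝ) : ℝ := Λ * (4 * (∫ z, kap N s z) + 2 ^ (N + 3)) + 2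

/-- the slice inequality functional -/
def sliceF {N : ℕ} (V : E N × ℝ → ℝ) (ψ : E N → ℝ) (x₀ : E N) (q ρ c : ℝ) (t : ℝ) : ℝ :=
  (∫ x, ψ x ^ 2 * V (x, t) ^ (-(q+1)) * dT V (x, t)) -
    (q+1)/2 * (∫ x, ψ x ^ 2 * V (x, t) ^ (-(q+2)) * ‖dX V (x, t)‖ ^ 2) +
    c * ∫ x in closedBall x₀ ρ, V (x, t) ^ (-q)

theorem sliceF_cont {N : ℕ} {V : E N × ℝ → ℝ} (hV : ContDiff ℝ (⊤ : ℕ∞) V) (hpos : ∀ p, 0 < V p)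
    {ψ : E N → ℝ} (hψ : Continuous ψ) (x₀ : E N) (q ρ c : ℝ)
    (hψs : ∀ x, x ∉ closedBall x₀ ρ → ψ x = 0) :
    Continuous (sliceF V ψ x₀ q ρ c) := by
  have hVc := hV.continuous
  have hTc := dT_cont hV
  have hXc := dX_cont hV
  have hr : ∀ a : ℝ, Continuous fun p => V p ^ a := fun a =>
    hVc.rpow_const fun p => Or.inl (hpos p).ne'
  have h1 := hr (-(q+1))
  have h2 := hr (-(q+2))
  have h3 := hr (-q)
  have k1 := par_cont (fun p => ψ p.1 ^ 2 * V p ^ (-(q+1)) * dT V p) (by fun_prop) x₀ ρ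
    (fun x t hx => by simp [hψs x hx])
  have k2 := par_cont (fun p => ψ p.1 ^ 2 * V p ^ (-(q+2)) * ‖dX V p‖ ^ 2) (by fun_prop) x₀ ρ
    (fun x t hx => by simp [hψs x hx])
  have k3 : Continuous fun t => ∫ x in closedBall x₀ ρ, V (x, t) ^ (-q) :=
    continuous_parametric_integral_of_continuous (f := fun t x => V (x, t) ^ (-q))
      (h3.comp continuous_swap) (isCompact_closedBall x₀ ρ)
  unfold sliceF
  exact (k1.sub (continuous_const.mul k2)).add (continuous_const.mul k3)

theorem slice (N : ℕ) (hN : 2 ≤ N) (s Λ : ℝ) (hs : s ∈ Ioo (0:ℝ) 1) (hΛ : 1 ≤ Λ)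
    (T : ℝ) (Ω : Set (E N)) (K : E N → E N → ℝ → ℝ) (u : E N → ℝ → ℝ)
    (x₀ : E N) (R r t₀ d l : ℝ) (hΩ : IsOpen Ω)
    (hK : KernelOK N s Λ T K) (hu : IsWeakSupersolution N T K Ω u)
    (hB : ball x₀ R ⊆ Ω) (hI : Ioo (t₀ - r ^ 2) t₀ ⊆ Ioo 0 T)
    (hu0 : ∀ x ∈ ball x₀ R, ∀ t ∈ Ioo (t₀ - r ^ 2) t₀, 0 ≤ u x t)
    (hr : 0 < r) (hrR : r < R / 2) (hd : 0 < d)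
    (hl : (r / R) ^ 2 * tailInfty N s (uminus N u) x₀ R (t₀ - r ^ 2) t₀ + d ≤ l)
    (V : E N × ℝ → ℝ) (O : Set (E N × ℝ)) (hV : ContDiff ℝ (⊤ : ℕ∞) V) (hpos : ∀ p, 0 < V p)
    (hO : IsOpen O) (ρ₀ a τ : ℝ) (hkO : closedBall x₀ ρ₀ ×ˢ Icc a τ ⊆ O)
    (hOD : O ⊆ ball x₀ R ×ˢ Ioo (t₀ - r ^ 2) t₀) (hVu : ∀ p ∈ O, V p = u p.1 p.2 + l)
    (hρ₀ : ρ₀ ≤ r)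
    (q L ρ : ℝ) (ψ : E N → ℝ) (hq : 0 < q) (hL1 : 1 ≤ L) (hLr : 1 / r ≤ L) (hρ : ρ ≤ ρ₀)
    (hψ : ContDiff ℝ (⊤ : ℕ∞) ψ) (hψ0 : ∀ x, 0 ≤ ψ x) (hψ1 : ∀ x, ψ x ≤ 1)
    (hψs : ∀ x, x ∉ closedBall x₀ ρ → ψ x = 0) (hψL : ∀ x y, |ψ x - ψ y| ≤ L * ‖x - y‖)
    (t₁ : ℝ) (ht₁ : t₁ ∈ Ioo a τ) :
    0 ≤ sliceF V ψ x₀ q ρ (C1 N s Λ * L ^ 2) t₁ := by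
  obtain ⟨hum, ⟨M, hM⟩, -, hweak⟩ := hu
  obtain ⟨hKm, hKs, hKb⟩ := hK
  have hR0 : 0 < R := by linarith
  obtain ⟨hdl, htail⟩ := tail_ae N hN s hs T M u x₀ R r t₀ d l hR0 hr hd hM hI hl
  have hVc := hV.continuous
  have hTc := dT_cont hV
  have hXc := dX_cont hV
  have hGc := gX_cont hV
  have hψc := hψ.continuous
  have hψdc : Continuous (fderiv ℝ ψ) := hψ.continuous_fderiv (by simp)
  have hrp : ∀ a : ℝ, Continuous fun p => V p ^ a := fun a =>
    hVc.rpow_const fun p => Or.inl (hpos p).ne'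
  have r1 := hrp (-(q+1))
  have r2 := hrp (-(q+2))
  have r3 := hrp (-q)
  have hψd : ∀ x, ‖fderiv ℝ ψ x‖ ≤ L := by
    intro x
    have : LipschitzWith (Real.toNNReal L) ψ := by
      apply LipschitzWith.of_dist_le_mul
      intro x y
      rw [Real.dist_eq, dist_eq_norm, Real.coe_toNNReal _ (by linarith)]
      exact hψL x y
    have h := norm_fderiv_le_of_lipschitz ℝ this (x₀ := x)
    rwa [Real.coe_toNNReal _ (by linarith)] at h
  have hψd0 : ∀ x, x ∉ closedBall x₀ ρ → fderiv ℝ ψ x = 0 := by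
    intro x hx
    have : ψ =ᶠ[nhds x] fun _ => 0 := by
      filter_upwards [isClosed_closedBall.isOpen_compl.mem_nhds hx] with y hy
      exact hψs y hy
    rw [this.fderiv_eq]; simp
  have hSc := sliceF_cont hV hpos hψc x₀ q ρ (C1 N s Λ * L ^ 2) hψs
  by_contra hneg
  push Not at hneg
  -- the time bump
  have hnb : {t | sliceF V ψ x₀ q ρ (C1 N s Λ * L ^ 2) t < 0} ∩ Ioo a τ ∈ nhds t₁ :=
    Filter.inter_mem ((isOpen_lt hSc continuous_const).mem_nhds hneg) (isOpen_Ioo.mem_nhds ht₁)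
  obtain ⟨χ, hχs, hχc, hχd, hχr, hχ1⟩ := exists_contDiff_tsupport_subset (n := ⊤) hnb
  have hχ0 : ∀ t, 0 ≤ χ t := fun t => (hχr ⟨t, rfl⟩).1
  have hχcont := hχd.continuous
  have hχz : ∀ t, t ∉ tsupport χ → χ t = 0 := fun t ht => image_eq_zero_of_notMem_tsupport ht
  have hχ'c : Continuous (deriv χ) := hχd.continuous_deriv (by simp)
  have hχ'z : ∀ t, t ∉ tsupport χ → deriv χ t = 0 := fun t ht => by
    have : χ =ᶠ[nhds t] fun _ => 0 := by
      filter_upwards [(isClosed_tsupport χ).isOpen_compl.mem_nhds ht] with y hy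
      exact hχz y hy
    rw [this.deriv_eq]; simp
  have hsupI : ∀ t ∈ tsupport χ, t ∈ Ioo a τ := fun t ht => (hχs ht).2
  have hinO : ∀ x t, x ∈ closedBall x₀ ρ → t ∈ tsupport χ → (x, t) ∈ O := fun x t hx ht =>
    hkO ⟨closedBall_subset_closedBall hρ hx, Ioo_subset_Icc_self (hsupI t ht)⟩
  have htI : ∀ t ∈ tsupport χ, t ∈ Ioo (t₀ - r ^ 2) t₀ := by
    intro t ht
    by_cases h0 : 0 ≤ ρ
    · exact (hOD (hinO x₀ t (mem_closedBall_self h0) ht)).2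
    · exfalso
      -- then everything is zero
      have e : closedBall x₀ ρ = ∅ := closedBall_eq_empty.2 (not_le.1 h0)
      have hz : ∀ x, ψ x = 0 := fun x => hψs x (by rw [e]; exact id)
      have : sliceF V ψ x₀ q ρ (C1 N s Λ * L ^ 2) t₁ = 0 := by
        unfold sliceF
        simp [hz, e]
      linarith
  -- the test function
  set ζ : E N × ℝ → ℝ := fun p => ψ p.1 ^ 2 * V p ^ (-(q+1)) with hζ
  have hζc : Continuous ζ := by fun_prop
  set φ : E N × ℝ → ℝ := fun p => χ p.2 * ζ p with hφ
  set φt : E N × ℝ → ℝ := fun p => deriv χ p.2 * ζ p +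
    χ p.2 * (ψ p.1 ^ 2 * (dT V p * (-(q+1)) * V p ^ (-(q+1) - 1))) with hφt
  have hφc : Continuous φ := by fun_prop
  have r1' := hrp (-(q+1)-1)
  have hφtc : Continuous φt := by fun_prop
  have hφsm : ContDiff ℝ (⊤ : ℕ∞) φ := by
    have hz : ContDiff ℝ (⊤ : ℕ∞) ζ :=
      ((hψ.comp contDiff_fst).pow 2).mul (hV.rpow_const_of_ne fun p => (hpos p).ne')
    exact (hχd.comp contDiff_snd).mul hz
  have hφz : ∀ x t, x ∉ closedBall x₀ ρ ∨ t ∉ tsupport χ → φ (x, t) = 0 := by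
    rintro x t (h | h)
    · simp [hφ, hζ, hψs x h]
    · simp [hφ, hχz t h]
  have hφtz : ∀ x t, x ∉ closedBall x₀ ρ ∨ t ∉ tsupport χ → φt (x, t) = 0 := by
    rintro x t (h | h)
    · simp [hφt, hζ, hψs x h]
    · simp [hφt, hχz t h, hχ'z t h]
  have hφd : ∀ x t, HasDerivAt (fun τ => φ (x, τ)) (φt (x, t)) t := by
    intro x t
    have d1 : HasDerivAt χ (deriv χ t) t := (hχd.differentiable (by simp) t).hasDerivAt
    have d2 := (dT_has hV x t).rpow_const (p := -(q+1)) (Or.inl (hpos (x, t)).ne')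
    have d3 := d1.mul (d2.const_mul (ψ x ^ 2))
    exact d3
  have hcs := cs_support φ x₀ ρ (tsupport χ) hχc hφz
  have hsub : closedBall x₀ ρ ×ˢ tsupport χ ⊆ Ω ×ˢ Ioo 0 T := by
    rintro ⟨x, t⟩ ⟨hx, ht⟩
    have := hOD (hinO x t hx ht)
    exact ⟨hB this.1, hI this.2⟩
  have hmain := hweak (fun x t => φ (x, t)) hφsm hcs.1 (hcs.2.trans hsub)
    (fun x t => mul_nonneg (hχ0 t) (mul_nonneg (sq_nonneg _) (Real.rpow_nonneg (hpos _).le _)))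
  -- reduction of double integrals
  have hred : ∀ F G : E N → ℝ → ℝ, (∀ x t, x ∈ closedBall x₀ ρ → t ∈ tsupport χ → F x t = G x t) →
      (∀ x t, x ∉ closedBall x₀ ρ ∨ t ∉ tsupport χ → F x t = 0) →
      (∀ x t, x ∉ closedBall x₀ ρ ∨ t ∉ tsupport χ → G x t = 0) →
      ∫ t in Ioo 0 T, ∫ x in Ω, F x t = ∫ t, ∫ x, G x t := by
    intro F G h1 h2 h3
    have hFG : F = G := by
      funext x t
      by_cases hx : x ∈ closedBall x₀ ρ
      · by_cases ht : t ∈ tsupport χ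
        · exact h1 x t hx ht
        · rw [h2 x t (Or.inr ht), h3 x t (Or.inr ht)]
      · rw [h2 x t (Or.inl hx), h3 x t (Or.inl hx)]
    subst hFG
    have hin : ∀ t, ∫ x in Ω, F x t = ∫ x, F x t := by
      intro t
      apply setIntegral_eq_integral_of_forall_compl_eq_zero
      intro x hx
      by_cases hxx : x ∈ closedBall x₀ ρ
      · by_cases ht : t ∈ tsupport χ
        · exact absurd (hsub (⟨hxx, ht⟩ : (x, t) ∈ closedBall x₀ ρ ×ˢ tsupport χ)).1 hx
        · exact h2 x t (Or.inr ht)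
      · exact h2 x t (Or.inl hxx)
    simp only [hin]
    apply setIntegral_eq_integral_of_forall_compl_eq_zero
    intro t ht
    have : ∀ x, F x t = 0 := fun x => h2 x t (Or.inr fun h => ht (hI (htI t h)))
    simp [this]
  -- term 1
  have T1 : -(∫ t in Ioo 0 T, ∫ x in Ω, u x t * deriv (fun τ => φ (x, τ)) t) =
      ∫ t, χ t * ∫ x, ψ x ^ 2 * V (x, t) ^ (-(q+1)) * dT V (x, t) := by
    have e1 := hred (fun x t => u x t * deriv (fun τ => φ (x, τ)) t)
      (fun x t => (V (x, t) - l) * φt (x, t))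
      (fun x t hx ht => by
        rw [(hφd x t).deriv, hVu _ (hinO x t hx ht)]; simp)
      (fun x t h => by simp only [(hφd x t).deriv, hφtz x t h, mul_zero])
      (fun x t h => by simp only [hφtz x t h, mul_zero])
    rw [e1, ibp_time hV hφc hφtc hφd x₀ ρ l (tsupport χ) hχc hφz hφtz]
    congr 1
    funext t
    rw [← integral_const_mul]
    congr 1
    funext x
    simp only [hφ, hζ]; ring
  -- term 2
  have T2 : (∫ t in Ioo 0 T, ∫ x in Ω,
          ⟪gradient (fun y => u y t) x, gradient (fun y => φ (y, t)) x⟫) =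
      ∫ t, χ t * ∫ x, gradTerm V ψ q (x, t) := by
    have hgφ : ∀ x t, fderiv ℝ (fun y => φ (y, t)) x = χ t • (ψ x ^ 2 • (((-(q+1)) * V (x, t) ^ (-(q+1) - 1)) • dX V (x, t)) +
        V (x, t) ^ (-(q+1)) • ((2 * ψ x) • fderiv ℝ ψ x)) := by
      intro x t
      have d1 := (dX_has hV x t).rpow_const (p := -(q+1)) (Or.inl (hpos (x, t)).ne')
      have d2 : HasFDerivAt (fun y => ψ y ^ 2) ((2 * ψ x) • fderiv ℝ ψ x) x := by
        have := ((hψ.differentiable (by simp) x).hasFDerivAt).pow 2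
        simpa using this
      have d3 := (d2.mul d1).const_mul (χ t)
      exact d3.fderiv
    have e1 := hred (fun x t => ⟪gradient (fun y => u y t) x, gradient (fun y => φ (y, t)) x⟫)
      (fun x t => χ t * gradTerm V ψ q (x, t))
      (fun x t hx ht => by
        have hfu : fderiv ℝ (fun y => u y t) x = dX V (x, t) := by
          have : (fun y => u y t) =ᶠ[nhds x] fun y => V (y, t) - l := by
            have hc : Continuous fun y : E N => (y, t) := by fun_prop
            filter_upwards [(hO.preimage hc).mem_nhds (hinO x t hx ht)] with y hy
            rw [hVu _ hy]; simp
          rw [this.fderiv_eq]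
          exact ((dX_has hV x t).sub_const l).fderiv
        rw [inner_grad _ _ _ _ _ hfu (hgφ x t)]
        change _ = χ t * gradTerm V ψ q (x, t)
        have e3 := dX_gX V (x, t)
        unfold gX at e3
        have e4 : -(q+1) - 1 = -(q+2) := by ring
        simp only [ContinuousLinearMap.smul_apply, ContinuousLinearMap.add_apply, smul_eq_mul, e3, e4, gradTerm, gX]
        ring)
      (fun x t h => by
        have : fderiv ℝ (fun y => φ (y, t)) x = 0 := by
          rw [hgφ]
          rcases h with h | h
          · simp [hψs x h]
          · simp [hχz t h]
        simp [gradient, this])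
      (fun x t h => by
        rcases h with h | h
        · simp [gradTerm, hψs x h]
        · simp [hχz t h])
    rw [e1]
    simp only [integral_const_mul]
  -- term 3
  set X : ℝ → ℝ := fun t => ∫ x in closedBall x₀ ρ, V (x, t) ^ (-q) with hX
  have hXcont : Continuous X :=
    continuous_parametric_integral_of_continuous (f := fun t x => V (x, t) ^ (-q))
      (r3.comp continuous_swap) (isCompact_closedBall x₀ ρ)
  set C0 : ℝ := Λ * (4 * (∫ z, kap N s z) + 2 ^ (N + 3)) with hC0
  have hC0n : 0 ≤ C0 := by
    have : 0 ≤ ∫ z, kap N s z := integral_nonneg (kap_nonneg N s)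
    positivity
  have hXn : ∀ t, 0 ≤ X t := fun t => integral_nonneg fun x => Real.rpow_nonneg (hpos _).le _
  have icχ : ∀ f : ℝ → ℝ, Continuous f → Integrable fun t => χ t * f t := fun f hf =>
    (hχcont.mul hf).integrable_of_hasCompactSupport hχc.mul_right
  have T3 : (∫ t in Ioo 0 T, ∫ x : E N, ∫ y : E N,
          (u x t - u y t) * (φ (x, t) - φ (y, t)) * K x y t) ≤ ∫ t, χ t * (C0 * L ^ 2 * X t) := by
    have hi := icχ (fun t => C0 * L ^ 2 * X t) (by fun_prop)
    have hnn : ∀ t, 0 ≤ χ t * (C0 * L ^ 2 * X t) := fun t => by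
      have := hχ0 t; have := hXn t; positivity
    refine le_trans (aux_integral_le (hi.integrableOn (s := Ioo 0 T)) (Filter.Eventually.of_forall hnn) ?_)
      (setIntegral_le_integral hi (Filter.Eventually.of_forall hnn))
    filter_upwards [ae_restrict_of_ae htail] with t ht
    by_cases hts : t ∈ tsupport χ
    · have htI' := htI t hts
      have htT := hI htI'
      have hb := nl_bound N hN s Λ hs hΛ (fun x y => K x y t) (fun x => u x t) (fun x => V (x, t)) ψ
        x₀ R r ρ l q L M (fun x y => hKs x y t)
        (fun x y hxy => le_trans (by positivity) (hKb x y hxy t htT).1)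
        (fun x y hxy => (hKb x y hxy t htT).2)
        (hum.comp (by fun_prop : Measurable fun x : E N => (x, t))) (fun x => hM x t htT)
        (fun x hx => hu0 x hx t htI') (by fun_prop) (fun x => hpos _)
        (fun x hx => hVu _ (hinO x t hx hts)) (by linarith) hr (hρ.trans hρ₀) hrR hq hL1 hLr
        hψ0 hψ1 hψs hψL (ht htI')
      have e : ∀ x y, (u x t - u y t) * (φ (x, t) - φ (y, t)) * K x y t =
          χ t * ((u x t - u y t) * (ψ x ^ 2 * V (x, t) ^ (-(q+1)) - ψ y ^ 2 * V (y, t) ^ (-(q+1))) * K x y t) := by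
        intro x y; simp only [hφ, hζ]; ring
      simp only [e, integral_const_mul]
      exact mul_le_mul_of_nonneg_left hb (hχ0 t)
    · have : ∀ x, φ (x, t) = 0 := fun x => hφz x t (Or.inr hts)
      simp [this, hχz t hts]
  -- combine
  have hgc : Continuous fun p => gradTerm V ψ q p := by
    unfold gradTerm
    fun_prop
  have hA := par_cont (fun p => ψ p.1 ^ 2 * V p ^ (-(q+1)) * dT V p) (by fun_prop) x₀ ρ
    (fun x t hx => by simp [hψs x hx])
  have hBc := par_cont (fun p => gradTerm V ψ q p) hgc x₀ ρ
    (fun x t hx => by simp [gradTerm, hψs x hx])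
  have hBle : ∀ t, ∫ x, gradTerm V ψ q (x, t) ≤
      -((q+1)/2) * (∫ x, ψ x ^ 2 * V (x, t) ^ (-(q+2)) * ‖dX V (x, t)‖ ^ 2) + 2 * L ^ 2 * X t := by
    intro t
    have i1 := slice_x (fun p => gradTerm V ψ q p) hgc x₀ ρ
      (fun x t hx => by simp [gradTerm, hψs x hx]) t
    have i2 := slice_x (fun p => ψ p.1 ^ 2 * V p ^ (-(q+2)) * ‖dX V p‖ ^ 2) (by fun_prop) x₀ ρ
      (fun x t hx => by simp [hψs x hx]) t
    have i3 : Integrable (indicator (closedBall x₀ ρ) fun x => V (x, t) ^ (-q)) := by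
      rw [integrable_indicator_iff measurableSet_closedBall]
      exact ContinuousOn.integrableOn_compact (isCompact_closedBall _ _)
        (r3.comp (by fun_prop : Continuous fun x : E N => (x, t))).continuousOn
    simp only [hX]
    rw [← integral_indicator measurableSet_closedBall]
    rw [← integral_const_mul, ← integral_const_mul, ← integral_add (i2.const_mul _) (i3.const_mul _)]
    apply integral_mono i1 ((i2.const_mul _).add (i3.const_mul _))
    intro x
    by_cases hx : x ∈ closedBall x₀ ρ
    · simp only [Pi.add_apply, indicator_of_mem hx]
      exact gradTerm_le V hpos ψ q L hq hψ0 hψd (x, t)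
    · simp only [Pi.add_apply, indicator_of_notMem hx]
      simp [gradTerm, hψs x hx]
  have hfin : 0 ≤ ∫ t, χ t * sliceF V ψ x₀ q ρ (C1 N s Λ * L ^ 2) t := by
    have hsum : 0 ≤ (∫ t, χ t * ∫ x, ψ x ^ 2 * V (x, t) ^ (-(q+1)) * dT V (x, t)) +
        (∫ t, χ t * ∫ x, gradTerm V ψ q (x, t)) + ∫ t, χ t * (C0 * L ^ 2 * X t) := by
      rw [← T1, ← T2]
      exact hmain.trans (by gcongr)
    have j1 := icχ _ hA
    have j2 := icχ _ hBc
    have j3 := icχ (fun t => C0 * L ^ 2 * X t) (by fun_prop)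
    rw [← integral_add j1 j2, ← integral_add (by exact j1.add j2) j3] at hsum
    refine hsum.trans (integral_mono (by exact (j1.add j2).add j3) (icχ _ hSc) fun t => ?_)
    have := mul_le_mul_of_nonneg_left (hBle t) (hχ0 t)
    simp only [sliceF, C1]
    rw [← hC0]
    simp only [hX] at this ⊢
    linarith
  have hstrict := Continuous.integral_pos_of_hasCompactSupport_nonneg_nonzero (μ := (volume : Measure ℝ))
    (f := fun t => χ t * (-sliceF V ψ x₀ q ρ (C1 N s Λ * L ^ 2) t)) (x := t₁) (by fun_prop)
    hχc.mul_right (fun t => by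
      by_cases hts : t ∈ tsupport χ
      · have := (hχs hts).1
        exact mul_nonneg (hχ0 t) (by simp only [mem_ofPred_eq] at this; linarith)
      · simp [hχz t hts]) (by
      simp only [hχ1, one_mul]; linarith)
  simp only [mul_neg, integral_neg] at hstrict
  linarith

theorem sob (N : ℕ) (hN : 2 ≤ N) : ∃ S : ℝ, 1 ≤ S ∧ ∀ h : E N → ℝ, ContDiff ℝ 1 h → HasCompactSupport h →
    (∀ x, 0 ≤ h x) →
    ∫ x, h x ^ (1 + 1 / (N:ℝ)) ≤ S * (∫ x, ‖fderiv ℝ h x‖) * (∫ x, h x) ^ (1 / (N:ℝ)) := by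
  have hN1 : (1:ℝ) < N := by exact_mod_cast (by omega : 1 < N)
  have hN0 : (0:ℝ) < N := by linarith
  set p : ℝ := N / (N - 1) with hp
  have hpN : Real.HolderConjugate (N:ℝ) p := by
    rw [Real.holderConjugate_iff]
    refine ⟨hN1, ?_⟩
    rw [hp]
    have : (N:ℝ) - 1 ≠ 0 := by linarith
    field_simp; ring
  have hp0 : 0 < p := hpN.symm.pos
  set c := lintegralPowLePowLIntegralFDerivConst (volume : Measure (E N)) p with hcdef
  have c0 : (0:ℝ) ≤ (c:ℝ) := c.2
  refine ⟨(c:ℝ) ^ (1/p) + 1, by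
    have := Real.rpow_nonneg c0 (1/p)
    change 0 ≤ (c:ℝ) ^ (1/p) at this
    linarith, ?_⟩
  intro h hh hs h0
  have hc := hh.continuous
  have hdc : Continuous (fderiv ℝ h) := hh.continuous_fderiv (by norm_num)
  have hds : HasCompactSupport (fderiv ℝ h) := hs.fderiv ℝ
  have ifd : Integrable (fderiv ℝ h) := hdc.integrable_of_hasCompactSupport hds
  have hpc : Continuous fun x => h x ^ p := hc.rpow_const fun x => Or.inr hp0.le
  have hps : HasCompactSupport fun x => h x ^ p := by
    apply hs.mono
    intro x hx
    simp only [Function.mem_support] at hx ⊢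
    intro h'
    exact hx (by rw [h', Real.zero_rpow hp0.ne'])
  have iP : Integrable (fun x => h x ^ p) := hpc.integrable_of_hasCompactSupport hps
  have h1 := lintegral_pow_le_pow_lintegral_fderiv (volume : Measure (E N)) hh hs (p := p)
    (by simpa using hpN)
  have e1 : ∫⁻ x, ‖h x‖ₑ ^ p = ENNReal.ofReal (∫ x, h x ^ p) := by
    rw [ofReal_integral_eq_lintegral_ofReal iP (Filter.Eventually.of_forall fun x => Real.rpow_nonneg (h0 x) _)]
    apply lintegral_congr
    intro x
    rw [Real.enorm_eq_ofReal (h0 x), ENNReal.ofReal_rpow_of_nonneg (h0 x) hp0.le]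
  set I1 := ∫ x, ‖fderiv ℝ h x‖ with hI1
  have hI1n : 0 ≤ I1 := integral_nonneg fun x => norm_nonneg _
  have hIPn : 0 ≤ ∫ x, h x ^ p := integral_nonneg fun x => Real.rpow_nonneg (h0 x) _
  have hIn : 0 ≤ ∫ x, h x := integral_nonneg h0
  have h2 : ∫ x, h x ^ p ≤ c * I1 ^ p := by
    rw [e1, ← ofReal_integral_norm_eq_lintegral_enorm ifd, ENNReal.ofReal_rpow_of_nonneg hI1n hp0.le,
      ← ENNReal.ofReal_coe_nnreal, ← hcdef, ← ENNReal.ofReal_mul c0] at h1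
    exact (ENNReal.ofReal_le_ofReal_iff (mul_nonneg c0 (Real.rpow_nonneg hI1n _))).1 h1
  have h3 : (∫ x, h x ^ p) ^ (1/p) ≤ c ^ (1/p) * I1 := by
    calc _ ≤ (c * I1 ^ p) ^ (1/p) := Real.rpow_le_rpow hIPn h2 (by positivity)
      _ = _ := by
        rw [Real.mul_rpow c0 (Real.rpow_nonneg hI1n _), ← Real.rpow_mul hI1n, mul_one_div_cancel hp0.ne',
          Real.rpow_one]
  have hNs : HasCompactSupport fun x => h x ^ (1/(N:ℝ)) := by
    apply hs.mono
    intro x hx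
    simp only [Function.mem_support] at hx ⊢
    intro h'
    exact hx (by rw [h', Real.zero_rpow (by positivity)])
  have hNc : Continuous fun x => h x ^ (1/(N:ℝ)) := hc.rpow_const fun x => Or.inr (by positivity)
  have h4 := integral_mul_le_Lp_mul_Lq_of_nonneg (μ := volume) hpN.symm (f := h) (g := fun x => h x ^ (1/(N:ℝ)))
    (Filter.Eventually.of_forall h0) (Filter.Eventually.of_forall fun x => Real.rpow_nonneg (h0 x) _)
    (hc.memLp_of_hasCompactSupport hs) (hNc.memLp_of_hasCompactSupport hNs)
  have e2 : ∀ x, (h x ^ (1/(N:ℝ))) ^ (N:ℝ) = h x := fun x => by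
    rw [← Real.rpow_mul (h0 x), one_div_mul_cancel hN0.ne', Real.rpow_one]
  have e3 : ∀ x, h x ^ (1 + 1/(N:ℝ)) = h x * h x ^ (1/(N:ℝ)) := fun x => by
    rw [Real.rpow_add_of_nonneg (h0 x) (by norm_num) (by positivity), Real.rpow_one]
  simp only [e2] at h4
  simp only [e3]
  refine h4.trans (mul_le_mul_of_nonneg_right ?_ (Real.rpow_nonneg hIn _))
  refine h3.trans ?_
  nlinarith

theorem par_deriv {N : ℕ} (G Gt : E N × ℝ → ℝ) (hG : Continuous G) (hGt : Continuous Gt)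
    (hd : ∀ x t, HasDerivAt (fun τ => G (x, τ)) (Gt (x, t)) t) (x₀ : E N) (ρ : ℝ)
    (h : ∀ x t, x ∉ closedBall x₀ ρ → G (x, t) = 0)
    (h' : ∀ x t, x ∉ closedBall x₀ ρ → Gt (x, t) = 0) (t : ℝ) :
    HasDerivAt (fun t => ∫ x, G (x, t)) (∫ x, Gt (x, t)) t := by
  obtain ⟨B, hB⟩ := ((isCompact_closedBall x₀ ρ).prod (isCompact_closedBall t 1)).exists_bound_of_continuousOn
    hGt.continuousOn
  refine (hasDerivAt_integral_of_dominated_loc_of_deriv_le (μ := volume) (F := fun t x => G (x, t))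
    (F' := fun t x => Gt (x, t)) (bound := indicator (closedBall x₀ ρ) fun _ => B)
    (ball_mem_nhds t one_pos) ?_ (slice_x G hG x₀ ρ h t) (slice_x Gt hGt x₀ ρ h' t).1 ?_ ?_ ?_).2
  · exact Filter.Eventually.of_forall fun t => (slice_x G hG x₀ ρ h t).1
  · refine Filter.Eventually.of_forall fun x τ hτ => ?_
    by_cases hx : x ∈ closedBall x₀ ρ
    · rw [indicator_of_mem hx]
      exact hB (x, τ) ⟨hx, ball_subset_closedBall hτ⟩
    · rw [indicator_of_notMem hx, h' x τ hx]; simp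
  · rw [integrable_indicator_iff measurableSet_closedBall]
    exact integrableOn_const (isCompact_closedBall _ _).measure_lt_top.ne
  · exact Filter.Eventually.of_forall fun x τ _ => hd x τ

/-- pointwise bound of the gradient of psi^2 V^{-q} -/
theorem grad_h {N : ℕ} {V : E N × ℝ → ℝ} (hV : ContDiff ℝ (⊤ : ℕ∞) V) (hpos : ∀ p, 0 < V p)
    {ψ : E N → ℝ} (hψ : ContDiff ℝ (⊤ : ℕ∞) ψ) (q L r : ℝ) (hq : 0 < q) (hr : 0 < r) (hL : 1 / r ≤ L)
    (hψ0 : ∀ x, 0 ≤ ψ x) (hψ1 : ∀ x, ψ x ≤ 1)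
    (hψL : ∀ x, ‖fderiv ℝ ψ x‖ ≤ L) (x : E N) (t : ℝ) :
    ContDiff ℝ 1 (fun x => ψ x ^ 2 * V (x, t) ^ (-q)) ∧
    ‖fderiv ℝ (fun x => ψ x ^ 2 * V (x, t) ^ (-q)) x‖ ≤
      r * (q ^ 2 / 2 * (ψ x ^ 2 * V (x, t) ^ (-(q+2)) * ‖dX V (x, t)‖ ^ 2)) + 3 * L * (V (x, t) ^ (-q)) := by
  have hp := hpos (x, t)
  have hs1 : ContDiff ℝ 1 fun x => V (x, t) := by
    have : ContDiff ℝ 1 V := hV.of_le (by norm_cast)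
    fun_prop
  have hψ1' : ContDiff ℝ 1 ψ := hψ.of_le (by norm_cast)
  constructor
  · exact (hψ1'.pow 2).mul (hs1.rpow_const_of_ne fun y => (hpos (y, t)).ne')
  have hVd := dX_has hV x t
  have hψd : HasFDerivAt ψ (fderiv ℝ ψ x) x :=
    (hψ1'.differentiable (by norm_num) x).hasFDerivAt
  have hd := (hψd.pow 2).mul (hVd.rpow_const (p := -q) (Or.inl hp.ne'))
  have hd' : fderiv ℝ (fun x => ψ x ^ 2 * V (x, t) ^ (-q)) x = _ := HasFDerivAt.fderiv hd
  rw [hd']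
  set A := V (x, t) ^ (-(q+2)) with hA
  have hApos : 0 < A := Real.rpow_pos_of_pos hp _
  have e1 : V (x, t) ^ (-q - 1) = A * V (x, t) := by
    rw [hA, ← Real.rpow_add_one hp.ne']; congr 1; ring
  have e2 : V (x, t) ^ (-q) = A * V (x, t) ^ 2 := by
    rw [hA, ← Real.rpow_natCast, ← Real.rpow_add hp]; congr 1; push_cast; ring
  rw [e1, e2]
  set w := V (x, t)
  set g := dX V (x, t)
  have hψx := hψ0 x
  have hψx1 := hψ1 x
  have hL0 : 0 < L := lt_of_lt_of_le (by positivity) hL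
  have b1 : ‖ψ x ^ 2 • ((-q * (A * w)) • g)‖ ≤ ψ x ^ 2 * (q * (A * w)) * ‖g‖ := by
    rw [norm_smul, norm_smul]
    simp only [Real.norm_eq_abs, abs_mul, abs_neg, abs_of_pos hq, abs_of_pos hApos, abs_of_pos hp, abs_pow,
      abs_of_nonneg hψx]
    exact le_of_eq (by ring)
  have b2 : ‖(A * w ^ 2) • ((2 * ψ x ^ (2 - 1)) • fderiv ℝ ψ x)‖ ≤ (A * w ^ 2) * (2 * 1 * L) := by
    rw [norm_smul, norm_smul]
    simp only [Real.norm_eq_abs, abs_mul, abs_of_pos hApos, abs_pow, abs_of_pos hp, abs_of_nonneg hψx,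
      Nat.add_one_sub_one, pow_one, abs_two]
    have := hψL x
    gcongr
  have b3 : ψ x ^ 2 * (q * (A * w)) * ‖g‖ ≤ r * (q ^ 2 / 2 * (ψ x ^ 2 * A * ‖g‖ ^ 2)) + (1/r) * (A * w^2) / 2 := by
    have h1 : 0 ≤ A * (r * (q * ψ x * ‖g‖ - w * ψ x / r) ^ 2) := by positivity
    have h2 : A * (r * (q * ψ x * ‖g‖ - w * ψ x / r) ^ 2) =
      2 * (r * (q ^ 2 / 2 * (ψ x ^ 2 * A * ‖g‖ ^ 2))) - 2 * (ψ x ^ 2 * (q * (A * w)) * ‖g‖) + (1/r) * (A * w^2) * ψ x ^2 := by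
      field_simp; ring
    have h3 : (1/r) * (A * w^2) * ψ x ^2 ≤ (1/r) * (A * w^2) * 1 := by
      gcongr
      nlinarith
    linarith
  have b4 : (1/r) * (A * w^2) ≤ L * (A * w^2) := by gcongr
  have hAw : 0 ≤ L * (A * w^2) := by positivity
  refine (norm_add_le _ _).trans ?_
  simp only [Pi.pow_apply, nsmul_eq_mul, Nat.cast_ofNat] at *
  refine (add_le_add b1 b2).trans ?_
  linarith

theorem ode_lem (X D g g' : ℝ → ℝ) (hX : Continuous X) (hD : Continuous D) (hg' : Continuous g')
    (hg : ∀ t, HasDerivAt g (g' t) t) (hX0 : ∀ t, 0 ≤ X t) (hD0 : ∀ t, 0 ≤ D t) (hg0 : ∀ t, 0 ≤ g t)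
    (hgX : ∀ t, g t ≤ X t) (k m a c b : ℝ) (hk : 0 ≤ k) (hm : 0 ≤ m) (hac : a < c) (hcb : c ≤ b)
    (hle : ∀ t ∈ Ioo a b, g' t + k * D t ≤ m * X t) :
    (∀ t ∈ Icc c b, (c - a) * g t ≤ (1 + (b - a) * m) * ∫ t in a..b, X t) ∧
    (c - a) * (k * ∫ t in c..b, D t) ≤ (1 + (b - a) * m) * ∫ t in a..b, X t := by
  have hgc : Continuous g := continuous_iff_continuousAt.2 fun t => (hg t).continuousAt
  have hP : 0 ≤ 1 + (b - a) * m := by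
    have := mul_nonneg (by linarith : 0 ≤ b - a) hm
    linarith
  have key : ∀ t₁ ∈ Icc c b, (t₁ - a) * g t₁ + ∫ t in a..t₁, (t - a) * (k * D t) ≤
      (1 + (b - a) * m) * ∫ t in a..b, X t := by
    intro t₁ ht
    have ha1 : a ≤ t₁ := by linarith [ht.1]
    have h1 : ∫ t in a..t₁, (1 * g t + (t - a) * g' t) = (t₁ - a) * g t₁ - (a - a) * g a := by
      apply intervalIntegral.integral_eq_sub_of_hasDerivAt (f := fun t => (t - a) * g t)
      · intro t _
        exact ((hasDerivAt_id t).sub_const a).mul (hg t)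
      · exact Continuous.intervalIntegrable (by fun_prop) _ _
    have h2 : ∫ t in a..t₁, (1 * g t + (t - a) * g' t) ≤
        ∫ t in a..t₁, ((1 + (b - a) * m) * X t - (t - a) * (k * D t)) := by
      apply intervalIntegral.integral_mono_on_of_le_Ioo ha1
        (Continuous.intervalIntegrable (by fun_prop) _ _) (Continuous.intervalIntegrable (by fun_prop) _ _)
      intro t htt
      have h3 := hle t ⟨htt.1, by linarith [htt.2, ht.2]⟩
      have h4 := mul_le_mul_of_nonneg_left h3 (by linarith [htt.1] : 0 ≤ t - a)
      have h5 : (t - a) * (m * X t) ≤ (b - a) * (m * X t) := by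
        apply mul_le_mul_of_nonneg_right (by linarith [htt.2, ht.2]) (mul_nonneg hm (hX0 t))
      have := hgX t
      nlinarith
    rw [intervalIntegral.integral_sub (Continuous.intervalIntegrable (by fun_prop) _ _)
      (Continuous.intervalIntegrable (by fun_prop) _ _), intervalIntegral.integral_const_mul] at h2
    have h6 : ∫ t in a..t₁, X t ≤ ∫ t in a..b, X t := by
      rw [← intervalIntegral.integral_add_adjacent_intervals (b := t₁) (c := b) (hX.intervalIntegrable _ _)
        (hX.intervalIntegrable _ _)]
      have := intervalIntegral.integral_nonneg (f := X) ht.2 (fun t _ => hX0 t) (μ := volume)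
      linarith
    have h7 := mul_le_mul_of_nonneg_left h6 hP
    linarith
  constructor
  · intro t ht
    have h1 := key t ht
    have h2 : 0 ≤ ∫ τ in a..t, (τ - a) * (k * D τ) :=
      intervalIntegral.integral_nonneg (by linarith [ht.1]) fun τ hτ =>
        mul_nonneg (by linarith [hτ.1]) (mul_nonneg hk (hD0 τ))
    have h3 : (c - a) * g t ≤ (t - a) * g t := mul_le_mul_of_nonneg_right (by linarith [ht.1]) (hg0 t)
    linarith
  · have h1 := key b ⟨hcb, le_rfl⟩
    have h2 : 0 ≤ (b - a) * g b := mul_nonneg (by linarith) (hg0 b)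
    have h3 : ∫ t in c..b, (c - a) * (k * D t) ≤ ∫ t in c..b, (t - a) * (k * D t) := by
      apply intervalIntegral.integral_mono_on hcb
        (Continuous.intervalIntegrable (by fun_prop) _ _) (Continuous.intervalIntegrable (by fun_prop) _ _)
      intro t ht
      exact mul_le_mul_of_nonneg_right (by linarith [ht.1]) (mul_nonneg hk (hD0 t))
    rw [intervalIntegral.integral_const_mul, intervalIntegral.integral_const_mul] at h3
    have h4 : 0 ≤ ∫ t in a..c, (t - a) * (k * D t) :=
      intervalIntegral.integral_nonneg hac.le fun τ hτ =>
        mul_nonneg (by linarith [hτ.1]) (mul_nonneg hk (hD0 τ))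
    rw [← intervalIntegral.integral_add_adjacent_intervals (b := c)
      (Continuous.intervalIntegrable (by fun_prop) _ _)
        (Continuous.intervalIntegrable (by fun_prop) _ _)] at h1
    linarith

/-- the slice inequality, packaged -/
def SliceOK {N : ℕ} (V : E N × ℝ → ℝ) (x₀ : E N) (r ρ₀ a τ c : ℝ) : Prop :=
  ∀ (q L ρ : ℝ) (ψ : E N → ℝ), 0 < q → 1 ≤ L → 1 / r ≤ L → ρ ≤ ρ₀ →
    ContDiff ℝ (⊤ : ℕ∞) ψ → (∀ x, 0 ≤ ψ x) → (∀ x, ψ x ≤ 1) →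
    (∀ x, x ∉ closedBall x₀ ρ → ψ x = 0) → (∀ x y, |ψ x - ψ y| ≤ L * ‖x - y‖) →
    ∀ t ∈ Ioo a τ, 0 ≤ sliceF V ψ x₀ q ρ (c * L ^ 2) t

/-- energy -/
def XX {N : ℕ} (V : E N × ℝ → ℝ) (x₀ : E N) (t₀ τ q ρ : ℝ) : ℝ :=
  ∫ t in (t₀ - ρ ^ 2)..τ, ∫ x in closedBall x₀ ρ, V (x, t) ^ (-q)

set_option maxHeartbeats 4000000 in
theorem revH_aux (N : ℕ) (hN : 2 ≤ N) (M S c : ℝ) (hM : 1 ≤ M) (hS : 1 ≤ S) (hc : 1 ≤ c)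
    (hSob : ∀ h : E N → ℝ, ContDiff ℝ 1 h → HasCompactSupport h →
    (∀ x, 0 ≤ h x) →
    ∫ x, h x ^ (1 + 1 / (N:ℝ)) ≤ S * (∫ x, ‖fderiv ℝ h x‖) * (∫ x, h x) ^ (1 / (N:ℝ)))
    {V : E N × ℝ → ℝ} (hV : ContDiff ℝ (⊤ : ℕ∞) V) (hpos : ∀ p, 0 < V p) (x₀ : E N) (r ρ₀ t₀ τ : ℝ)
    (hr : 0 < r) (hr1 : r ≤ 1) (hρ₀ : ρ₀ ≤ r) (hτ : τ < t₀)
    (hsl : SliceOK V x₀ r ρ₀ (t₀ - ρ₀ ^ 2) τ c)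
    (q ρ₁ ρ₂ : ℝ) (hq : 0 < q) (h2 : r / 2 ≤ ρ₂) (h21 : ρ₂ < ρ₁) (h10 : ρ₁ ≤ ρ₀)
    (hτ2 : t₀ - ρ₂ ^ 2 ≤ τ)
    (ψ : E N → ℝ) (hψ : ContDiff ℝ (⊤ : ℕ∞) ψ) (hψ0 : ∀ x, 0 ≤ ψ x) (hψ1 : ∀ x, ψ x ≤ 1)
    (hψs : ∀ x, x ∉ closedBall x₀ ρ₁ → ψ x = 0) (hψe : ∀ x ∈ closedBall x₀ ρ₂, ψ x = 1)
    (hψL : ∀ x y, |ψ x - ψ y| ≤ M / (ρ₁ - ρ₂) * ‖x - y‖) :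
    XX V x₀ t₀ τ (q * (1 + 1 / (N:ℝ))) ρ₂ ≤ 4 * S * r *
      (c * M ^ 2 * (1 + q) * (r / (ρ₁ - ρ₂) ^ 3) * XX V x₀ t₀ τ q ρ₁) ^ (1 + 1 / (N:ℝ)) := by
  have hN0 : (0:ℝ) < N := by exact_mod_cast (by omega : 0 < N)
  set δ := ρ₁ - ρ₂ with hδ
  have hδ0 : 0 < δ := by linarith
  have hδr : δ ≤ r := by linarith
  set L := M / δ with hL
  have hLr : 1 / r ≤ L := by
    rw [hL, div_le_div_iff₀ hr hδ0]; nlinarith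
  have hL1 : 1 ≤ L := le_trans (by rw [le_div_iff₀ hr]; linarith) hLr
  have hVc := hV.continuous
  have hTc := dT_cont hV
  have hXc := dX_cont hV
  have hψc := hψ.continuous
  have hrp : ∀ a : ℝ, Continuous fun p => V p ^ a := fun a =>
    hVc.rpow_const fun p => Or.inl (hpos p).ne'
  have r0 := hrp (-q)
  have r1 := hrp (-(q+1))
  have r2 := hrp (-(q+2))
  have rχ := hrp (-(q * (1 + 1 / (N:ℝ))))
  set X : ℝ → ℝ := fun t => ∫ x in closedBall x₀ ρ₁, V (x, t) ^ (-q) with hX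
  set D : ℝ → ℝ := fun t => ∫ x, ψ x ^ 2 * V (x, t) ^ (-(q+2)) * ‖dX V (x, t)‖ ^ 2 with hD
  set g : ℝ → ℝ := fun t => ∫ x, ψ x ^ 2 * V (x, t) ^ (-q) with hg
  set G : ℝ → ℝ := fun t => ∫ x, ψ x ^ 2 * V (x, t) ^ (-(q+1)) * dT V (x, t) with hG
  have cX : Continuous X := continuous_parametric_integral_of_continuous (f := fun t x => V (x, t) ^ (-q))
      (r0.comp continuous_swap) (isCompact_closedBall x₀ ρ₁)
  have cD : Continuous D := par_cont (fun p => ψ p.1 ^ 2 * V p ^ (-(q+2)) * ‖dX V p‖ ^ 2) (by fun_prop) x₀ ρ₁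
    (fun x t hx => by simp [hψs x hx])
  have cG : Continuous G := par_cont (fun p => ψ p.1 ^ 2 * V p ^ (-(q+1)) * dT V p) (by fun_prop) x₀ ρ₁
    (fun x t hx => by simp [hψs x hx])
  have dg : ∀ t, HasDerivAt g (-q * G t) t := by
    intro t
    have := par_deriv (fun p => ψ p.1 ^ 2 * V p ^ (-q)) (fun p => -q * (ψ p.1 ^ 2 * V p ^ (-(q+1)) * dT V p))
      (by fun_prop) (by fun_prop) (fun x t => by
        have h := ((dT_has hV x t).rpow_const (p := -q) (Or.inl (hpos (x, t)).ne')).const_mul (ψ x ^ 2)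
        refine h.congr_deriv ?_
        rw [show -q - 1 = -(q+1) by ring]; ring) x₀ ρ₁ (fun x t hx => by simp [hψs x hx])
      (fun x t hx => by simp [hψs x hx]) t
    rw [integral_const_mul] at this
    exact this
  have X0 : ∀ t, 0 ≤ X t := fun t => integral_nonneg fun x => Real.rpow_nonneg (hpos _).le _
  have D0 : ∀ t, 0 ≤ D t := fun t => integral_nonneg fun x => by
    have := (Real.rpow_pos_of_pos (hpos (x, t)) (-(q+2))).le
    positivity
  have g0 : ∀ t, 0 ≤ g t := fun t => integral_nonneg fun x => by
    have := (Real.rpow_pos_of_pos (hpos (x, t)) (-q)).le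
    positivity
  have iB : ∀ (b ρ t : ℝ), Integrable (indicator (closedBall x₀ ρ) fun x => V (x, t) ^ b) := by
    intro b ρ t
    rw [integrable_indicator_iff measurableSet_closedBall]
    exact ContinuousOn.integrableOn_compact (isCompact_closedBall _ _)
        ((hrp b).comp (by fun_prop : Continuous fun x : E N => (x, t))).continuousOn
  have XI : ∀ t, X t = ∫ x, indicator (closedBall x₀ ρ₁) (fun x => V (x, t) ^ (-q)) x := fun t =>
    (integral_indicator measurableSet_closedBall).symm
  have ig : ∀ t, Integrable fun x => ψ x ^ 2 * V (x, t) ^ (-q) := fun t =>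
    slice_x (fun p => ψ p.1 ^ 2 * V p ^ (-q)) (by fun_prop) x₀ ρ₁ (fun x t hx => by simp [hψs x hx]) t
  have gX' : ∀ t, g t ≤ X t := by
    intro t
    rw [XI]
    apply integral_mono (ig t) (iB _ _ _)
    intro x
    by_cases hx : x ∈ closedBall x₀ ρ₁
    · simp only [indicator_of_mem hx]
      have := (Real.rpow_pos_of_pos (hpos (x, t)) (-q)).le
      have h1 := hψ0 x
      have h2 := hψ1 x
      have : ψ x ^ 2 ≤ 1 := by nlinarith
      nlinarith
    · simp [hψs x hx, indicator_of_notMem hx]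
  have hode := ode_lem X D g (fun t => -q * G t) cX cD (by fun_prop) dg X0 D0 g0 gX' (q * (q+1) / 2)
    (q * (c * L ^ 2)) (t₀ - ρ₁ ^ 2) (t₀ - ρ₂ ^ 2) τ (by positivity) (by positivity) (by nlinarith) hτ2 (by
      intro t ht
      have h := hsl q L ρ₁ ψ hq hL1 hLr h10 hψ hψ0 hψ1 hψs hψL t ⟨by nlinarith [ht.1], ht.2⟩
      have h' : 0 ≤ G t - (q+1)/2 * D t + c * L^2 * X t := h
      have := mul_nonneg hq.le h'
      nlinarith)
  obtain ⟨ho1, ho2⟩ := hode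
  set 𝒳 := XX V x₀ t₀ τ q ρ₁ with h𝒳
  have e𝒳 : 𝒳 = ∫ t in (t₀ - ρ₁ ^ 2)..τ, X t := rfl
  rw [← e𝒳] at ho1 ho2
  have hat : t₀ - ρ₁ ^ 2 ≤ τ := by nlinarith
  have h𝒳0 : 0 ≤ 𝒳 := intervalIntegral.integral_nonneg hat fun t _ => X0 t
  set B := c * M ^ 2 * (1 + q) * (r / δ ^ 3) * 𝒳 with hB
  have hB0 : 0 ≤ B := by positivity
  have hcoef : (1 + (τ - (t₀ - ρ₁ ^ 2)) * (q * (c * L ^ 2))) * 𝒳 ≤ (δ * r) * B := by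
    have h1 : τ - (t₀ - ρ₁ ^ 2) ≤ r ^ 2 := by nlinarith
    have h2 : (δ * r) * B = (c * M ^ 2 * (1 + q) * (r / δ) ^ 2) * 𝒳 := by
      rw [hB]; field_simp
    rw [h2]
    apply mul_le_mul_of_nonneg_right _ h𝒳0
    have h3 : (τ - (t₀ - ρ₁ ^ 2)) * (q * (c * L ^ 2)) ≤ r ^ 2 * (q * (c * L ^ 2)) := by gcongr
    have h4 : r ^ 2 * (q * (c * L ^ 2)) = c * M^2 * q * (r / δ) ^ 2 := by rw [hL]; field_simp
    have h5 : 1 ≤ c * M^2 * (r / δ) ^ 2 := by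
      have : 1 ≤ r / δ := by rw [le_div_iff₀ hδ0]; linarith
      have a1 : 1 ≤ (r/δ)^2 := one_le_pow₀ this
      have a2 : 1 ≤ M^2 := one_le_pow₀ hM
      have a3 : 1 ≤ c * M^2 := one_le_mul_of_one_le_of_one_le hc a2
      exact one_le_mul_of_one_le_of_one_le a3 a1
    linarith
  have hgap : δ * r ≤ (t₀ - ρ₂ ^ 2) - (t₀ - ρ₁ ^ 2) := by
    have : (t₀ - ρ₂ ^ 2) - (t₀ - ρ₁ ^ 2) = δ * (ρ₁ + ρ₂) := by rw [hδ]; ring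
    rw [this]
    apply mul_le_mul_of_nonneg_left _ hδ0.le
    linarith
  have hδr0 : 0 < δ * r := by positivity
  have hgB : ∀ t ∈ Icc (t₀ - ρ₂ ^ 2) τ, g t ≤ B := by
    intro t ht
    have h1 := (ho1 t ht).trans hcoef
    have h2 := (mul_le_mul_of_nonneg_right hgap (g0 t)).trans h1
    exact le_of_mul_le_mul_left h2 hδr0
  set 𝒟 := ∫ t in (t₀ - ρ₂ ^ 2)..τ, D t with h𝒟
  have h𝒟0 : 0 ≤ 𝒟 := intervalIntegral.integral_nonneg hτ2 fun t _ => D0 t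
  have hDB : q * (q+1) / 2 * 𝒟 ≤ B := by
    have h1 := ho2.trans hcoef
    have h2 := (mul_le_mul_of_nonneg_right hgap (by positivity : 0 ≤ q * (q+1) / 2 * 𝒟)).trans h1
    exact le_of_mul_le_mul_left h2 hδr0
  -- derivative bound of psi
  have hψd : ∀ x, ‖fderiv ℝ ψ x‖ ≤ L := fun x => by
    have : LipschitzWith (Real.toNNReal L) ψ := LipschitzWith.of_dist_le' fun x y => by
      rw [Real.dist_eq, dist_eq_norm]; exact hψL x y
    have := norm_fderiv_le_of_lipschitz ℝ this (x₀ := x)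
    rwa [Real.coe_toNNReal _ (by linarith)] at this
  have hL0 : 0 < L := by linarith
  -- slice Sobolev
  have hslice : ∀ t ∈ Icc (t₀ - ρ₂ ^ 2) τ, ∫ x in closedBall x₀ ρ₂, V (x, t) ^ (-(q * (1 + 1 / (N:ℝ)))) ≤
      S * B ^ (1 / (N:ℝ)) * (r * (q ^ 2 / 2 * D t) + 3 * L * X t) := by
    intro t ht
    set h : E N → ℝ := fun x => ψ x ^ 2 * V (x, t) ^ (-q) with hh
    have hh0 : ∀ x, 0 ≤ h x := fun x =>
      mul_nonneg (sq_nonneg _) (Real.rpow_pos_of_pos (hpos (x, t)) (-q)).le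
    have hgr := fun x => grad_h hV hpos hψ q L r hq hr hLr hψ0 hψ1 hψd x t
    have hhs : HasCompactSupport h :=
      HasCompactSupport.intro (isCompact_closedBall x₀ ρ₁) fun x hx => by simp [hh, hψs x hx]
    have hs := hSob h (hgr x₀).1 hhs hh0
    have hhc : Continuous h := (hgr x₀).1.continuous
    have hχc : Continuous fun x => h x ^ (1 + 1 / (N:ℝ)) := hhc.rpow_const fun x => Or.inr (by positivity)
    have hχi : Integrable fun x => h x ^ (1 + 1 / (N:ℝ)) := by
      apply hχc.integrable_of_hasCompactSupport
      exact HasCompactSupport.intro (isCompact_closedBall x₀ ρ₁) fun x hx => by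
        have : h x = 0 := by simp [hh, hψs x hx]
        rw [this, Real.zero_rpow (by positivity)]
    have l1 : ∫ x in closedBall x₀ ρ₂, V (x, t) ^ (-(q * (1 + 1 / (N:ℝ)))) ≤ ∫ x, h x ^ (1 + 1 / (N:ℝ)) := by
      rw [← integral_indicator measurableSet_closedBall]
      apply integral_mono (iB _ _ _) hχi
      intro x
      by_cases hx : x ∈ closedBall x₀ ρ₂
      · simp only [indicator_of_mem hx, hh, hψe x hx, one_pow, one_mul]
        rw [← Real.rpow_mul (hpos _).le]
        exact le_of_eq (by congr 1; ring)
      · simp only [indicator_of_notMem hx]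
        exact Real.rpow_nonneg (hh0 x) _
    have iD := slice_x (fun p => ψ p.1 ^ 2 * V p ^ (-(q+2)) * ‖dX V p‖ ^ 2) (by fun_prop) x₀ ρ₁
      (fun x t hx => by simp [hψs x hx]) t
    have l2 : ∫ x, ‖fderiv ℝ h x‖ ≤ r * (q ^ 2 / 2 * D t) + 3 * L * X t := by
      rw [XI]
      simp only [hD]
      rw [← integral_const_mul, ← integral_const_mul, ← integral_const_mul,
        ← integral_add ((iD.const_mul _).const_mul _) ((iB _ _ _).const_mul _)]
      apply integral_mono
      · exact (((hgr x₀).1.continuous_fderiv (by norm_num)).integrable_of_hasCompactSupport (hhs.fderiv ℝ)).norm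
      · exact ((iD.const_mul _).const_mul _).add ((iB _ _ _).const_mul _)
      intro x
      by_cases hx : x ∈ closedBall x₀ ρ₁
      · simp only [indicator_of_mem hx]
        exact (hgr x).2
      · simp only [indicator_of_notMem hx]
        have : IsLocalMin h x := Filter.Eventually.of_forall fun y => by
          have : h x = 0 := by simp [hh, hψs x hx]
          rw [this]; exact hh0 y
        rw [this.fderiv_eq_zero]
        simp [hψs x hx]
    have l3 : (∫ x, h x) ^ (1 / (N:ℝ)) ≤ B ^ (1 / (N:ℝ)) :=
      Real.rpow_le_rpow (g0 t) (hgB t ht) (by positivity)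
    have hn : 0 ≤ ∫ x, ‖fderiv ℝ h x‖ := integral_nonneg fun x => norm_nonneg _
    have hBn : 0 ≤ B ^ (1 / (N:ℝ)) := Real.rpow_nonneg hB0 _
    calc _ ≤ _ := l1
      _ ≤ S * (∫ x, ‖fderiv ℝ h x‖) * (∫ x, h x) ^ (1 / (N:ℝ)) := hs
      _ ≤ S * (∫ x, ‖fderiv ℝ h x‖) * B ^ (1 / (N:ℝ)) := by gcongr
      _ ≤ S * (r * (q ^ 2 / 2 * D t) + 3 * L * X t) * B ^ (1 / (N:ℝ)) := by gcongr
      _ = _ := by ring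
  have cXχ : Continuous fun t => ∫ x in closedBall x₀ ρ₂, V (x, t) ^ (-(q * (1 + 1 / (N:ℝ)))) :=
    continuous_parametric_integral_of_continuous
      (f := fun t x => V (x, t) ^ (-(q * (1 + 1 / (N:ℝ)))))
      (rχ.comp continuous_swap) (isCompact_closedBall x₀ ρ₂)
  have hfin : XX V x₀ t₀ τ (q * (1 + 1 / (N:ℝ))) ρ₂ ≤
      ∫ t in (t₀ - ρ₂ ^ 2)..τ, S * B ^ (1 / (N:ℝ)) * (r * (q ^ 2 / 2 * D t) + 3 * L * X t) := by
    unfold XX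
    exact intervalIntegral.integral_mono_on hτ2 (cXχ.intervalIntegrable _ _)
      (Continuous.intervalIntegrable (by fun_prop) _ _) hslice
  refine hfin.trans ?_
  rw [intervalIntegral.integral_const_mul, intervalIntegral.integral_add
    (Continuous.intervalIntegrable (by fun_prop) _ _) (Continuous.intervalIntegrable (by fun_prop) _ _),
    intervalIntegral.integral_const_mul, intervalIntegral.integral_const_mul, intervalIntegral.integral_const_mul]
  have hX2 : ∫ t in (t₀ - ρ₂ ^ 2)..τ, X t ≤ 𝒳 := by
    rw [e𝒳, ← intervalIntegral.integral_add_adjacent_intervals (a := t₀ - ρ₁ ^ 2) (b := t₀ - ρ₂ ^ 2) (cX.intervalIntegrable _ _)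
        (cX.intervalIntegrable _ _)]
    have := intervalIntegral.integral_nonneg (f := X) (by nlinarith : t₀ - ρ₁ ^ 2 ≤ t₀ - ρ₂ ^ 2)
      (fun t _ => X0 t) (μ := volume)
    linarith
  have m1 : q ^ 2 / 2 * 𝒟 ≤ B := by
    refine le_trans ?_ hDB
    apply mul_le_mul_of_nonneg_right _ h𝒟0
    nlinarith
  have m2 : L * 𝒳 ≤ r * B := by
    have : r * B = (c * (1 + q) * (M * (r / δ) ^ 2)) * (L * 𝒳) := by rw [hB, hL]; field_simp
    rw [this]
    apply le_mul_of_one_le_left (by positivity)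
    have : 1 ≤ r / δ := by rw [le_div_iff₀ hδ0]; linarith
    have a1 : 1 ≤ (r/δ)^2 := one_le_pow₀ this
    exact one_le_mul_of_one_le_of_one_le (one_le_mul_of_one_le_of_one_le hc (by linarith))
      (one_le_mul_of_one_le_of_one_le hM a1)
  have m3 : r * (q ^ 2 / 2 * 𝒟) + 3 * L * (∫ t in (t₀ - ρ₂ ^ 2)..τ, X t) ≤ 4 * r * B := by
    have := mul_le_mul_of_nonneg_left m1 hr.le
    have := mul_le_mul_of_nonneg_left hX2 hL0.le
    nlinarith
  have e : B ^ (1 + 1 / (N:ℝ)) = B * B ^ (1 / (N:ℝ)) := by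
    rw [Real.rpow_add_of_nonneg hB0 (by norm_num) (by positivity), Real.rpow_one]
  rw [e]
  have hBn : 0 ≤ B ^ (1 / (N:ℝ)) := Real.rpow_nonneg hB0 _
  calc _ ≤ S * B ^ (1 / (N:ℝ)) * (4 * r * B) := by gcongr
    _ = _ := by ring

theorem seq_lem (N : ℕ) (hN : 2 ≤ N) (Y : ℕ → ℝ) (P b : ℝ) (hP : 1 ≤ P) (hb : 1 ≤ b) (hY : ∀ k, 0 ≤ Y k)
    (hrec : ∀ k : ℕ, Y (k+1) ≤ (P * b ^ k * Y k) ^ (1 + 1 / (N:ℝ))) (k : ℕ) :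
    Y k ≤ (P ^ (N+1) * b ^ (N*(N+1)) * Y 0) ^ ((1 + 1 / (N:ℝ)) ^ k) := by
  have hN0 : (0:ℝ) < N := by exact_mod_cast (by omega : 0 < N)
  set χ := 1 + 1 / (N:ℝ) with hχ
  have hχ0 : 0 < χ := by positivity
  have hP0 : 0 < P := by linarith
  have hb0 : 0 < b := by linarith
  have hχN : χ * N = N + 1 := by rw [hχ]; field_simp
  set W : ℕ → ℝ := fun k => Y k * (P ^ ((N:ℝ)+1) * b ^ (((N:ℝ)+1) * k + N * (N+1))) with hW
  have W0 : ∀ k, 0 ≤ W k := fun k => by have := hY k; positivity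
  have step : ∀ k, W (k+1) ≤ W k ^ χ := by
    intro k
    have e : W k ^ χ = (P * b ^ k * Y k) ^ χ * (P ^ ((N:ℝ)+1) * b ^ (((N:ℝ)+1) * (k+1:ℕ) + N * (N+1))) := by
      simp only [hW]
      rw [Real.mul_rpow (hY k) (by positivity), Real.mul_rpow (by positivity) (by positivity),
        Real.mul_rpow (by positivity) (hY k), Real.mul_rpow (by positivity) (by positivity)]
      rw [← Real.rpow_natCast, ← Real.rpow_mul hP0.le, ← Real.rpow_mul hb0.le, ← Real.rpow_mul hb0.le]
      have a1 : P ^ (((N:ℝ)+1) * χ) = P ^ χ * P ^ ((N:ℝ)+1) := by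
        rw [← Real.rpow_add hP0]; congr 1; linarith
      have a2 : b ^ ((((N:ℝ)+1) * k + N * (N+1)) * χ) = b ^ (k * χ) * b ^ (((N:ℝ)+1) * (k+1:ℕ) + N * (N+1)) := by
        rw [← Real.rpow_add hb0]; congr 1; push_cast
        linear_combination (k + (N:ℝ) + 1) * hχN
      rw [a1, a2]; ring
    rw [e]
    exact mul_le_mul_of_nonneg_right (hrec k) (by positivity)
  have hW1 : ∀ k, W k ≤ W 0 ^ (χ ^ k) := by
    intro k
    induction k with
    | zero => simp
    | succ k ih =>
      calc W (k+1) ≤ W k ^ χ := step k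
        _ ≤ (W 0 ^ (χ ^ k)) ^ χ := Real.rpow_le_rpow (W0 k) ih hχ0.le
        _ = _ := by rw [← Real.rpow_mul (W0 0), pow_succ]
  have e0 : W 0 = P ^ (N+1) * b ^ (N*(N+1)) * Y 0 := by
    simp only [hW]
    rw [← Real.rpow_natCast, ← Real.rpow_natCast]
    push_cast
    ring_nf
  rw [← e0]
  refine le_trans ?_ (hW1 k)
  apply le_mul_of_one_le_right (hY k)
  exact one_le_mul_of_one_le_of_one_le (Real.one_le_rpow hP (by positivity)) (Real.one_le_rpow hb (by positivity))

theorem lim_lem (χ μ C ζ Z : ℝ) (hχ : 1 < χ) (hμ : 0 < μ) (hζ : 0 < ζ) (hZ : 0 ≤ Z)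
    (h : ∀ k : ℕ, μ * ζ ^ (χ ^ k) ≤ C * Z ^ (χ ^ k)) : ζ ≤ Z := by
  by_contra hlt
  push Not at hlt
  have h1 : Filter.Tendsto (fun k : ℕ => C * (Z / ζ) ^ (χ ^ k)) Filter.atTop (nhds (C * 0)) := by
    apply Filter.Tendsto.const_mul
    have := tendsto_rpow_atTop_of_base_lt_one (Z / ζ) (by have : 0 ≤ Z / ζ := by positivity
                                                          linarith) (by rw [div_lt_one hζ]; exact hlt)
    exact this.comp (tendsto_pow_atTop_atTop_of_one_lt hχ)
  have h2 : ∀ k : ℕ, μ ≤ C * (Z / ζ) ^ (χ ^ k) := by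
    intro k
    rw [Real.div_rpow hZ hζ.le, ← mul_div_assoc, le_div_iff₀ (by positivity)]
    exact h k
  have := ge_of_tendsto' h1 h2
  linarith

theorem XX_lower {N : ℕ} {V : E N × ℝ → ℝ} (hV : Continuous V) (hpos : ∀ p, 0 < V p) (x₀ x₁ : E N)
    (t₀ τ q ρ t₁ ε w : ℝ) (hε : 0 < ε) (hw : 0 ≤ w) (h1 : closedBall x₁ ε ⊆ closedBall x₀ ρ)
    (h2 : t₀ - ρ ^ 2 ≤ t₁ - ε) (h3 : t₁ + ε ≤ τ)
    (h : ∀ x ∈ closedBall x₁ ε, ∀ t ∈ Icc (t₁ - ε) (t₁ + ε), w ≤ V (x, t) ^ (-q)) :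
    (2 * ε * volume.real (closedBall x₁ ε)) * w ≤ XX V x₀ t₀ τ q ρ := by
  have hc : Continuous fun p => V p ^ (-q) := hV.rpow_const fun p => Or.inl (hpos p).ne'
  have iB : ∀ (z : E N) (ρ t : ℝ), IntegrableOn (fun x => V (x, t) ^ (-q)) (closedBall z ρ) := by
    intro z ρ t
    exact ContinuousOn.integrableOn_compact (isCompact_closedBall _ _)
        (hc.comp (by fun_prop : Continuous fun x : E N => (x, t))).continuousOn
  have cX : Continuous fun t => ∫ x in closedBall x₀ ρ, V (x, t) ^ (-q) :=
    continuous_parametric_integral_of_continuous (f := fun t x => V (x, t) ^ (-q))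
      (hc.comp continuous_swap) (isCompact_closedBall x₀ ρ)
  have X0 : ∀ t, 0 ≤ ∫ x in closedBall x₀ ρ, V (x, t) ^ (-q) :=
    fun t => integral_nonneg fun x => Real.rpow_nonneg (hpos _).le _
  have s1 : ∫ t in (t₁ - ε)..(t₁ + ε), ∫ x in closedBall x₀ ρ, V (x, t) ^ (-q) ≤ XX V x₀ t₀ τ q ρ := by
    unfold XX
    apply intervalIntegral.integral_mono_interval h2 (by linarith) h3
    · exact Filter.Eventually.of_forall X0
    · exact cX.intervalIntegrable _ _
  refine le_trans ?_ s1
  have s2 : ∫ t in (t₁ - ε)..(t₁ + ε), volume.real (closedBall x₁ ε) * w ≤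
      ∫ t in (t₁ - ε)..(t₁ + ε), ∫ x in closedBall x₀ ρ, V (x, t) ^ (-q) := by
    apply intervalIntegral.integral_mono_on (by linarith) (by simp) (cX.intervalIntegrable _ _)
    intro t ht
    calc volume.real (closedBall x₁ ε) * w = ∫ x in closedBall x₁ ε, w := by simp
      _ ≤ ∫ x in closedBall x₁ ε, V (x, t) ^ (-q) := by
        apply setIntegral_mono_on _ (iB _ _ _) measurableSet_closedBall
        · intro x hx; exact h x hx t ht
        · exact integrableOn_const (isCompact_closedBall _ _).measure_lt_top.ne
      _ ≤ _ := by
        apply setIntegral_mono_set (iB _ _ _)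
        · exact Filter.Eventually.of_forall fun x => Real.rpow_nonneg (hpos _).le _
        · exact h1.eventuallyLE
  refine le_trans (le_of_eq ?_) s2
  simp
  ring

set_option maxHeartbeats 4000000 in
theorem moser (N : ℕ) (hN : 2 ≤ N) (M S c : ℝ) (hM : 1 ≤ M) (hS : 1 ≤ S) (hc : 1 ≤ c)
    (hSob : ∀ h : E N → ℝ, ContDiff ℝ 1 h → HasCompactSupport h →
    (∀ x, 0 ≤ h x) →
    ∫ x, h x ^ (1 + 1 / (N:ℝ)) ≤ S * (∫ x, ‖fderiv ℝ h x‖) * (∫ x, h x) ^ (1 / (N:ℝ)))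
    (hcut : ∀ (N : ℕ) (x₀ : E N) (ρ₂ ρ₁ : ℝ), 0 < ρ₂ → ρ₂ < ρ₁ → ∃ ψ : E N → ℝ,
      ContDiff ℝ (⊤ : ℕ∞) ψ ∧ (∀ x, 0 ≤ ψ x) ∧ (∀ x, ψ x ≤ 1) ∧ (∀ x, x ∉ closedBall x₀ ρ₁ → ψ x = 0) ∧
      (∀ x ∈ closedBall x₀ ρ₂, ψ x = 1) ∧ (∀ x y, |ψ x - ψ y| ≤ M / (ρ₁ - ρ₂) * ‖x - y‖))
    {V : E N × ℝ → ℝ} (hV : ContDiff ℝ (⊤ : ℕ∞) V) (hpos : ∀ p, 0 < V p) (x₀ : E N) (r ρ ρ' t₀ τ β : ℝ)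
    (hr : 0 < r) (hr1 : r ≤ 1) (hρ : ρ ≤ r) (hρ' : r / 2 ≤ ρ') (hρρ : ρ' < ρ) (hτ : τ < t₀)
    (hτ' : t₀ - ρ' ^ 2 ≤ τ) (hβ : 0 < β) (hβ1 : β < 1)
    (hsl : SliceOK V x₀ r ρ (t₀ - ρ ^ 2) τ c) (x₁ : E N) (t₁ : ℝ) (hx₁ : x₁ ∈ ball x₀ ρ')
    (ht₁ : t₁ ∈ Ioo (t₀ - ρ' ^ 2) τ) :
    V (x₁, t₁) ^ (-β) ≤ (64 * S * c * M ^ 2 * (r / (ρ - ρ')) ^ 3) ^ (N+1) * 16 ^ (N*(N+1)) *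
      ((r ^ (N+2))⁻¹ * XX V x₀ t₀ τ β ρ) := by
  have hN0 : (0:ℝ) < N := by exact_mod_cast (by omega : 0 < N)
  have hN2 : (2:ℝ) ≤ N := by exact_mod_cast hN
  set χ := 1 + 1 / (N:ℝ) with hχ
  have hχ1 : 1 < χ := by rw [hχ]; have : 0 < 1 / (N:ℝ) := by positivity
                         linarith
  have hχ2 : χ ≤ 2 := by
    rw [hχ]; have : 1 / (N:ℝ) ≤ 1 := by rw [div_le_one hN0]; linarith
    linarith
  have hχN : (N:ℝ) * χ = N + 1 := by rw [hχ]; field_simp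
  set P := 64 * S * c * M ^ 2 * (r / (ρ - ρ')) ^ 3 with hP
  have hdel : 0 < ρ - ρ' := by linarith
  have hP1 : 1 ≤ P := by
    have a0 : 1 ≤ r / (ρ - ρ') := by rw [le_div_iff₀ hdel]; linarith
    have a1 : 1 ≤ (r / (ρ - ρ')) ^ 3 := one_le_pow₀ a0
    have a2 : 1 ≤ M ^ 2 := one_le_pow₀ hM
    exact one_le_mul_of_one_le_of_one_le (one_le_mul_of_one_le_of_one_le
      (one_le_mul_of_one_le_of_one_le (by linarith) hc) a2) a1
  set ρk : ℕ → ℝ := fun k => ρ' + (ρ - ρ') / 2 ^ k with hρk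
  have hρk1 : ∀ k, ρ' < ρk k := fun k => by
    have : 0 < (ρ - ρ') / 2 ^ k := by positivity
    simp only [hρk]; linarith
  have hρk2 : ∀ k, ρk k ≤ ρ := fun k => by
    have : (ρ - ρ') / 2 ^ k ≤ ρ - ρ' := div_le_self hdel.le (one_le_pow₀ (by norm_num))
    simp only [hρk]; linarith
  have hρkd : ∀ k, ρk k - ρk (k+1) = (ρ - ρ') / 2 ^ (k+1) := fun k => by
    simp only [hρk]; rw [pow_succ]; field_simp; ring
  set Y : ℕ → ℝ := fun k => (r ^ (N+2))⁻¹ * XX V x₀ t₀ τ (β * χ ^ k) (ρk k) with hY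
  have hVc := hV.continuous
  have hXX0 : ∀ q ρ'' : ℝ, ρ' ≤ ρ'' → 0 ≤ XX V x₀ t₀ τ q ρ'' := fun q ρ'' h =>
    intervalIntegral.integral_nonneg (by nlinarith) fun t _ =>
      integral_nonneg fun x => Real.rpow_nonneg (hpos _).le _
  have hY0 : ∀ k, 0 ≤ Y k := fun k => mul_nonneg (by positivity) (hXX0 _ _ (hρk1 k).le)
  have hrec : ∀ k : ℕ, Y (k+1) ≤ (P * 16 ^ k * Y k) ^ χ := by
    intro k
    have hq : 0 < β * χ ^ k := by positivity
    have hlt : ρk (k+1) < ρk k := by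
      have := hρkd k
      have : 0 < (ρ - ρ') / 2 ^ (k+1) := by positivity
      linarith
    have hpos' : 0 < ρk (k+1) := by linarith [hρk1 (k+1)]
    obtain ⟨ψ, c1, c2, c3, c4, c5, c6⟩ := hcut N x₀ (ρk (k+1)) (ρk k) hpos' hlt
    have h1 := revH_aux N hN M S c hM hS hc hSob hV hpos x₀ r ρ t₀ τ hr hr1 hρ hτ hsl (β * χ ^ k) (ρk k)
      (ρk (k+1)) hq (by linarith [hρk1 (k+1)]) hlt (hρk2 k) (by nlinarith [hρk1 (k+1)]) ψ c1 c2 c3 c4 c5 c6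
    rw [hρkd, ← hχ, mul_assoc β, ← pow_succ] at h1
    have hXk := hXX0 (β * χ ^ k) _ (hρk1 k).le
    have eXk : XX V x₀ t₀ τ (β * χ ^ k) (ρk k) = r ^ (N+2) * Y k := by
      simp only [hY]; field_simp
    have hYk := hY0 k
    have step1 : Y (k+1) ≤ (r ^ (N+2))⁻¹ * (4 * S * r *
      (c * M ^ 2 * (1 + β * χ ^ k) * (r / ((ρ - ρ') / 2 ^ (k+1)) ^ 3) * (r ^ (N+2) * Y k)) ^ χ) := by
      rw [← eXk]
      exact mul_le_mul_of_nonneg_left h1 (by positivity)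
    set A := c * M ^ 2 * (1 + β * χ ^ k) * (r / ((ρ - ρ') / 2 ^ (k+1))) ^ 3 * Y k with hA
    have hA0 : 0 ≤ A := by positivity
    have e1 : c * M ^ 2 * (1 + β * χ ^ k) * (r / ((ρ - ρ') / 2 ^ (k+1)) ^ 3) * (r ^ (N+2) * Y k) = r ^ N * A := by
      rw [hA]; field_simp; ring
    have e2 : (r ^ N * A) ^ χ = r ^ (N+1) * A ^ χ := by
      rw [Real.mul_rpow (by positivity) hA0]
      congr 1
      rw [← Real.rpow_natCast, ← Real.rpow_natCast, ← Real.rpow_mul hr.le, hχN]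
      push_cast; rfl
    rw [e1, e2] at step1
    have e3 : (r ^ (N+2))⁻¹ * (4 * S * r * (r ^ (N+1) * A ^ χ)) = 4 * S * A ^ χ := by
      field_simp; ring
    rw [e3] at step1
    have step2 : 4 * S * A ^ χ ≤ (4 * S * A) ^ χ := by
      rw [Real.mul_rpow (by positivity) hA0]
      apply mul_le_mul_of_nonneg_right _ (by positivity)
      exact Real.self_le_rpow_of_one_le (by linarith) hχ1.le
    refine step1.trans (step2.trans (Real.rpow_le_rpow (by positivity) ?_ (by positivity)))
    have hb : 1 + β * χ ^ k ≤ 2 * 2 ^ k := by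
      have b1 : χ ^ k ≤ 2 ^ k := pow_le_pow_left₀ (by positivity) hχ2 k
      have b2 : (1:ℝ) ≤ 2 ^ k := one_le_pow₀ (by norm_num)
      nlinarith [pow_pos (by linarith : 0 < χ) k]
    calc 4 * S * A ≤ 4 * S * (c * M ^ 2 * (2 * 2 ^ k) * (r / ((ρ - ρ') / 2 ^ (k+1))) ^ 3 * Y k) := by
          rw [hA]; gcongr
      _ = P * (2 ^ k * (2 ^ k) ^ 3) * Y k := by
          rw [hP, pow_succ]; field_simp; ring
      _ = P * 16 ^ k * Y k := by
          rw [show (16:ℝ) = 2 * 2 ^ 3 by norm_num, mul_pow]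
          congr 2; rw [← pow_mul, ← pow_mul, mul_comm k 3]
  have hseq := seq_lem N hN Y P 16 hP1 (by norm_num) hY0 hrec
  have eY0 : Y 0 = (r ^ (N+2))⁻¹ * XX V x₀ t₀ τ β ρ := by
    simp only [hY, hρk, pow_zero, mul_one, div_one]
    congr 2; ring
  rw [← eY0]
  set Z := P ^ (N+1) * 16 ^ (N*(N+1)) * Y 0 with hZ
  have hZ0 : 0 ≤ Z := by have := hY0 0; positivity
  by_contra hcon
  push Not at hcon
  obtain ⟨ζ, hζ1, hζ2⟩ := exists_between hcon
  have hζ0 : 0 < ζ := lt_of_le_of_lt hZ0 hζ1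
  -- neighbourhood
  have hc0 : Continuous fun p => V p ^ (-β) := hVc.rpow_const fun p => Or.inl (hpos p).ne'
  have hopen : IsOpen ((ball x₀ ρ' ×ˢ Ioo (t₀ - ρ' ^ 2) τ) ∩ {p | ζ < V p ^ (-β)}) :=
    (isOpen_ball.prod isOpen_Ioo).inter (isOpen_lt continuous_const hc0)
  obtain ⟨ε, hε, hεs⟩ := nhds_basis_closedBall.mem_iff.1 (hopen.mem_nhds (x := (x₁, t₁)) ⟨⟨hx₁, ht₁⟩, hζ2⟩)
  rw [← closedBall_prod_same, Real.closedBall_eq_Icc] at hεs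
  have hx1m : x₁ ∈ closedBall x₁ ε := mem_closedBall_self hε.le
  have hmu : 0 < 2 * ε * volume.real (closedBall x₁ ε) := by
    have : 0 < volume.real (closedBall x₁ ε) :=
      ENNReal.toReal_pos (measure_closedBall_pos volume x₁ hε).ne' (isCompact_closedBall _ _).measure_lt_top.ne
    positivity
  have := lim_lem χ (2 * ε * volume.real (closedBall x₁ ε)) (r ^ (N+2)) ζ Z hχ1 hmu hζ0 hZ0 (by
    intro k
    have hk := hseq k
    have hlow := XX_lower hVc hpos x₀ x₁ t₀ τ (β * χ ^ k) (ρk k) t₁ ε (ζ ^ (χ ^ k)) hε (by positivity)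
      (fun x hx => by
        have := (hεs (a := (x, t₁)) ⟨hx, by constructor <;> linarith⟩).1.1
        exact closedBall_subset_closedBall (hρk1 k).le (ball_subset_closedBall this))
      (by
        have := (hεs (a := (x₁, t₁ - ε)) ⟨hx1m, by constructor <;> linarith⟩).1.2.1
        have := hρk1 k
        simp only at *
        nlinarith)
      (by
        have := (hεs (a := (x₁, t₁ + ε)) ⟨hx1m, by constructor <;> linarith⟩).1.2.2
        exact le_of_lt this)
      (fun x hx t ht => by
        have h : ζ < V (x, t) ^ (-β) := (hεs (a := (x, t)) ⟨hx, ht⟩).2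
        have e : V (x, t) ^ (-(β * χ ^ k)) = (V (x, t) ^ (-β)) ^ (χ ^ k) := by
          rw [← Real.rpow_mul (hpos _).le]; congr 1; ring
        rw [e]
        exact Real.rpow_le_rpow hζ0.le h.le (by positivity))
    refine hlow.trans ?_
    have e : XX V x₀ t₀ τ (β * χ ^ k) (ρk k) = r ^ (N+2) * Y k := by
      simp only [hY]; field_simp
    rw [e]
    exact mul_le_mul_of_nonneg_left hk (by positivity))
  linarith

theorem C1_ge (N : ℕ) (s Λ : ℝ) (hΛ : 1 ≤ Λ) : 1 ≤ C1 N s Λ := by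
  unfold C1
  have : 0 ≤ ∫ z, kap N s z := integral_nonneg fun z => kap_nonneg N s z
  have : 0 ≤ Λ * (4 * (∫ z, kap N s z) + 2 ^ (N + 3)) := by positivity
  linarith

theorem XX_le {N : ℕ} {V F : E N × ℝ → ℝ} (hV : Continuous V) (hpos : ∀ p, 0 < V p) (x₀ : E N)
    (t₀ τ β ρ : ℝ) (h : t₀ - ρ ^ 2 ≤ τ) (U : Set (E N × ℝ)) (hU : MeasurableSet U)
    (hsub : closedBall x₀ ρ ×ˢ Icc (t₀ - ρ ^ 2) τ ⊆ U) (hF : IntegrableOn F U) (hF0 : ∀ p ∈ U, 0 ≤ F p)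
    (hVF : ∀ p ∈ closedBall x₀ ρ ×ˢ Icc (t₀ - ρ ^ 2) τ, V p ^ (-β) = F p) :
    XX V x₀ t₀ τ β ρ ≤ ∫ p in U, F p := by
  have hc : Continuous fun p => V p ^ (-β) := hV.rpow_const fun p => Or.inl (hpos p).ne'
  have hm : MeasurableSet (closedBall x₀ ρ ×ˢ Icc (t₀ - ρ ^ 2) τ) :=
    measurableSet_closedBall.prod measurableSet_Icc
  have hi : IntegrableOn (fun p => V p ^ (-β)) (closedBall x₀ ρ ×ˢ Icc (t₀ - ρ ^ 2) τ) :=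
    hc.continuousOn.integrableOn_compact ((isCompact_closedBall _ _).prod isCompact_Icc)
  have e : XX V x₀ t₀ τ β ρ = ∫ p in closedBall x₀ ρ ×ˢ Icc (t₀ - ρ ^ 2) τ, V p ^ (-β) := by
    unfold XX
    rw [intervalIntegral.integral_of_le h, ← integral_Icc_eq_integral_Ioc]
    rw [Measure.volume_eq_prod, ← Measure.prod_restrict]
    rw [integral_prod_symm]
    rw [Measure.prod_restrict]; exact hi
  rw [e, setIntegral_congr_fun hm hVF]
  apply setIntegral_mono_set hF
  · exact (ae_restrict_iff' hU).2 (Filter.Eventually.of_forall hF0)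
  · exact hsub.eventuallyLE

set_option maxHeartbeats 4000000 in
theorem stmt_12 (N : ℕ) (hN : 2 ≤ N) :
    ∃ θ : ℝ, 0 < θ ∧
      ∀ s Λ : ℝ, s ∈ Set.Ioo (0 : ℝ) 1 → 1 ≤ Λ →
        ∃ C : ℝ, 0 < C ∧
          ∀ (T : ℝ) (Ω : Set (E N)) (K : E N → E N → ℝ → ℝ) (u : E N → ℝ → ℝ)
            (x₀ : E N) (R r t₀ d l : ℝ),
            0 < T → IsOpen Ω → Bornology.IsBounded Ω →
            KernelOK N s Λ T K → IsWeakSupersolution N T K Ω u →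
            Metric.ball x₀ R ⊆ Ω → Set.Ioo (t₀ - r ^ 2) t₀ ⊆ Set.Ioo 0 T →
            (∀ x ∈ Metric.ball x₀ R, ∀ t ∈ Set.Ioo (t₀ - r ^ 2) t₀, 0 ≤ u x t) →
            0 < r → r ≤ 1 → r < R / 2 → 0 < d →
            (r / R) ^ 2 * tailInfty N s (uminus N u) x₀ R (t₀ - r ^ 2) t₀ + d ≤ l →
            ∀ β σ' σ : ℝ, 0 < β → β < 1 → 1 / 2 ≤ σ' → σ' < σ → σ ≤ 1 →
              essSup (fun p : E N × ℝ => (u p.1 p.2 + l)⁻¹)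
                  (volume.restrict
                    ((Metric.ball x₀ (σ' * r)) ×ˢ Set.Ioo (t₀ - (σ' * r) ^ 2) t₀)) ≤
                (C * (σ - σ') ^ (-θ)) ^ (1 / β) *
                  (⨍ p in (Metric.ball x₀ (σ * r)) ×ˢ Set.Ioo (t₀ - (σ * r) ^ 2) t₀,
                    (u p.1 p.2 + l) ^ (-β)) ^ (1 / β) := by
  refine ⟨3 * ((N:ℝ) + 1), by positivity, ?_⟩
  intro s Λ hs hΛ
  obtain ⟨M, hM, hcut⟩ := aux_cutoff
  obtain ⟨S, hS, hSob⟩ := sob N hN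
  set c := C1 N s Λ with hcdef
  have hc : 1 ≤ c := C1_ge N s Λ hΛ
  set ω := volume.real (ball (0 : E N) 1) with hω
  have hω0 : 0 < ω :=
    ENNReal.toReal_pos (measure_ball_pos volume _ one_pos).ne' measure_ball_lt_top.ne
  set C := (64 * S * c * M ^ 2 * 8) ^ (N+1) * 16 ^ (N*(N+1)) * ω with hC
  have hC0 : 0 < C := by positivity
  refine ⟨C, hC0, ?_⟩
  intro T Ω K u x₀ R r t₀ d l hT hΩ hΩb hK hu hB hI hu0 hr hr1 hrR hd hl β σ' σ hβ hβ1 hσ' hσσ hσ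
  have hR0 : 0 < R := by linarith
  obtain ⟨hum, ⟨Mu, hMu⟩, hsm, -⟩ := id hu
  obtain ⟨hdl, -⟩ := tail_ae N hN s hs T Mu u x₀ R r t₀ d l hR0 hr hd hMu hI hl
  set U := (ball x₀ (σ * r)) ×ˢ Ioo (t₀ - (σ * r) ^ 2) t₀ with hU
  set F : E N × ℝ → ℝ := fun p => (u p.1 p.2 + l) ^ (-β) with hF
  have hσr : σ * r ≤ r := by nlinarith
  have hσ0 : 0 < σ := by linarith
  have hUm : MeasurableSet U := measurableSet_ball.prod measurableSet_Ioo
  have hUD : U ⊆ ball x₀ R ×ˢ Ioo (t₀ - r ^ 2) t₀ := by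
    apply prod_mono
    · exact ball_subset_ball (by linarith)
    · exact Ioo_subset_Ioo_left (by nlinarith [mul_pos hσ0 hr])
  have hvd : ∀ p ∈ ball x₀ R ×ˢ Ioo (t₀ - r ^ 2) t₀, d ≤ u p.1 p.2 + l := fun p hp => by
    have := hu0 p.1 hp.1 p.2 hp.2
    linarith
  have hUvol : volume.real U = ω * (σ * r) ^ (N + 2) := by
    have e1 : volume.real U = volume.real (ball x₀ (σ * r)) * volume.real (Ioo (t₀ - (σ * r) ^ 2) t₀) := by
      rw [hU, Measure.volume_eq_prod, measureReal_prod_prod]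
    have e2 : volume.real (ball x₀ (σ * r)) = (σ * r) ^ N * ω := by
      rw [hω, measureReal_def, measureReal_def, Measure.addHaar_ball_of_pos _ _ (by positivity), ENNReal.toReal_mul]
      rw [ENNReal.toReal_ofReal (by positivity)]
      simp
    rw [e1, e2, Real.volume_real_Ioo_of_le (by nlinarith [sq_nonneg (σ * r)])]
    ring
  have hUvol0 : 0 < volume.real U := by rw [hUvol]; positivity
  have hUfin : volume U ≠ ⊤ := fun h => by
    rw [measureReal_def, h] at hUvol0; simp at hUvol0
  have hFm : Measurable F := by
    have : Measurable fun p : E N × ℝ => u p.1 p.2 + l := hum.add_const l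
    exact this.pow_const _
  have hF0 : ∀ p ∈ U, 0 ≤ F p := fun p hp =>
    Real.rpow_nonneg (by linarith [hvd p (hUD hp)]) _
  have hFi : IntegrableOn F U := by
    apply Measure.integrableOn_of_bounded (M := d ^ (-β)) hUfin hFm.aestronglyMeasurable
    refine (ae_restrict_iff' hUm).2 (Filter.Eventually.of_forall fun p hp => ?_)
    rw [Real.norm_of_nonneg (hF0 p hp)]
    exact Real.rpow_le_rpow_of_nonpos hd (hvd p (hUD hp)) (by linarith)
  set A := ⨍ p in U, F p with hA
  have hAint : ∫ p in U, F p = volume.real U * A := by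
    rw [hA, setAverage_eq, smul_eq_mul]
    field_simp
  have hA0 : 0 ≤ A := by
    have : 0 ≤ ∫ p in U, F p := setIntegral_nonneg hUm hF0
    rw [hAint] at this
    exact nonneg_of_mul_nonneg_right this hUvol0
  -- pointwise bound
  have hpt : ∀ p ∈ ball x₀ (σ' * r) ×ˢ Ioo (t₀ - (σ' * r) ^ 2) t₀,
      0 < u p.1 p.2 + l ∧ (u p.1 p.2 + l) ^ (-β) ≤ C * (σ - σ') ^ (-(3 * ((N:ℝ) + 1))) * A := by
    rintro ⟨x₁, t₁⟩ ⟨hx₁, ht₁⟩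
    simp only at hx₁ ht₁
    set ρ := (σ' + σ) / 2 * r with hρ
    have hρ'ρ : σ' * r < ρ := by rw [hρ]; nlinarith
    have hρσ : ρ < σ * r := by rw [hρ]; nlinarith
    have hσ'r : r / 2 ≤ σ' * r := by nlinarith
    set τ := (t₁ + t₀) / 2 with hτ
    have hτ1 : t₁ < τ := by rw [hτ]; linarith [ht₁.2]
    have hτ2 : τ < t₀ := by rw [hτ]; linarith [ht₁.2]
    have hτ' : t₀ - (σ' * r) ^ 2 ≤ τ := by linarith [ht₁.1]
    have hρ0 : 0 < ρ := by linarith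
    have hsq1 : ρ ^ 2 < (σ * r) ^ 2 := by gcongr
    have hsq2 : (σ' * r) ^ 2 < ρ ^ 2 := pow_lt_pow_left₀ hρ'ρ (by positivity) two_ne_zero
    have hkU : closedBall x₀ ρ ×ˢ Icc (t₀ - ρ ^ 2) τ ⊆ U := by
      apply prod_mono
      · exact closedBall_subset_ball hρσ
      · intro t ht; exact ⟨by linarith [ht.1], by linarith [ht.2]⟩
    obtain ⟨V, O, hV, hVpos, hO, hkO, hOD, hVu⟩ := aux_global
      (D := ball x₀ R ×ˢ Ioo (t₀ - r ^ 2) t₀) (k := closedBall x₀ ρ ×ˢ Icc (t₀ - ρ ^ 2) τ)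
      (V := fun p => u p.1 p.2 + l) (isOpen_ball.prod isOpen_Ioo)
      ((isCompact_closedBall _ _).prod isCompact_Icc) (hkU.trans hUD)
      ((hsm.mono (prod_mono hB hI)).add contDiffOn_const)
      (fun p hp => by have := hvd p hp; linarith)
    have hsl : SliceOK V x₀ r ρ (t₀ - ρ ^ 2) τ c := by
      intro q L ρ₁ ψ h1 h2 h3 h4 h5 h6 h7 h8 h9 t ht
      exact slice N hN s Λ hs hΛ T Ω K u x₀ R r t₀ d l hΩ hK hu hB hI hu0 hr hrR hd hl V O hV hVpos hO
        ρ (t₀ - ρ ^ 2) τ hkO hOD hVu (by linarith) q L ρ₁ ψ h1 h2 h3 h4 h5 h6 h7 h8 h9 t ht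
    have hmos := moser N hN M S c hM hS hc hSob hcut hV hVpos x₀ r ρ (σ' * r) t₀ τ β hr hr1 (by linarith)
      hσ'r hρ'ρ hτ2 hτ' hβ hβ1 hsl x₁ t₁ hx₁ ⟨ht₁.1, hτ1⟩
    have hmem : (x₁, t₁) ∈ closedBall x₀ ρ ×ˢ Icc (t₀ - ρ ^ 2) τ :=
      ⟨closedBall_subset_closedBall hρ'ρ.le (ball_subset_closedBall hx₁), by linarith [ht₁.1], hτ1.le⟩
    rw [hVu _ (hkO hmem)] at hmos
    have hXle := XX_le hV.continuous hVpos x₀ t₀ τ β ρ (by linarith) U hUm hkU hFi hF0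
      (fun p hp => by simp only [hF]; rw [hVu p (hkO hp)])
    refine ⟨by linarith [hvd _ (hUD (hkU hmem))], hmos.trans ?_⟩
    rw [hAint, hUvol] at hXle
    have hrat : (r ^ (N+2))⁻¹ * XX V x₀ t₀ τ β ρ ≤ ω * A := by
      rw [inv_mul_le_iff₀ (by positivity)]
      refine hXle.trans ?_
      have : (σ * r) ^ (N+2) ≤ r ^ (N+2) := pow_le_pow_left₀ (by positivity) hσr _
      calc ω * (σ * r) ^ (N+2) * A ≤ ω * r ^ (N+2) * A := by gcongr
        _ = _ := by ring
    have hds : 0 < σ - σ' := by linarith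
    have e1 : r / (ρ - σ' * r) = 2 / (σ - σ') := by
      have : ρ - σ' * r = (σ - σ') * r / 2 := by rw [hρ]; ring
      rw [this]; field_simp
    have e2 : (σ - σ') ^ (-(3 * ((N:ℝ) + 1))) = ((1 / (σ - σ')) ^ 3) ^ (N+1) := by
      rw [← pow_mul, one_div, inv_pow, ← Real.rpow_natCast, Real.rpow_neg hds.le]
      push_cast; rfl
    rw [e1, e2]
    calc _ ≤ (64 * S * c * M ^ 2 * (2 / (σ - σ')) ^ 3) ^ (N+1) * 16 ^ (N*(N+1)) * (ω * A) := by
          gcongr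
      _ = _ := by
          rw [hC, show 64 * S * c * M ^ 2 * (2 / (σ - σ')) ^ 3 =
            (64 * S * c * M ^ 2 * 8) * (1 / (σ - σ')) ^ 3 by field_simp; ring, mul_pow]
          ring
  have hds : 0 < σ - σ' := by linarith
  set U' := ball x₀ (σ' * r) ×ˢ Ioo (t₀ - (σ' * r) ^ 2) t₀ with hU'
  have hU'm : MeasurableSet U' := measurableSet_ball.prod measurableSet_Ioo
  have hσ'r0 : 0 < σ' * r := by nlinarith
  have hU'o : IsOpen U' := isOpen_ball.prod isOpen_Ioo
  have hU'ne : U'.Nonempty :=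
    ⟨(x₀, t₀ - (σ' * r) ^ 2 / 2), mem_ball_self hσ'r0, by
      have : 0 < (σ' * r) ^ 2 := by positivity
      constructor <;> simp only <;> linarith⟩
  have hne : (volume.restrict U') ≠ 0 := by
    rw [Ne, Measure.restrict_eq_zero]
    exact (hU'o.measure_pos volume hU'ne).ne'
  have : (ae (volume.restrict U')).NeBot := ae_neBot.2 hne
  rw [← Real.mul_rpow (by positivity) hA0]
  unfold essSup
  apply Filter.limsup_le_of_le
  · apply Filter.isCoboundedUnder_le_of_eventually_le _ (x := 0)
    refine (ae_restrict_iff' hU'm).2 (Filter.Eventually.of_forall fun p hp => ?_)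
    exact (inv_pos.2 (hpt p hp).1).le
  · refine (ae_restrict_iff' hU'm).2 (Filter.Eventually.of_forall fun p hp => ?_)
    obtain ⟨h0, h1⟩ := hpt p hp
    have e : (u p.1 p.2 + l)⁻¹ = ((u p.1 p.2 + l) ^ (-β)) ^ (1 / β) := by
      rw [← Real.rpow_mul h0.le, neg_mul, mul_one_div_cancel hβ.ne', Real.rpow_neg_one]
    rw [e]
    exact Real.rpow_le_rpow (Real.rpow_nonneg h0.le _) h1 (by positivity)
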